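/- arXiv:2011.01626 — 3 statements merged into one kernel-verified Lean document; each statement's English description precedes it below -/
import Mathlib

section
/- There exists N₀ ∈ ℕ such that for all integers a ≥ 2 and all integers n ≥ N₀, ex_Π(n, 7, 21a + 9) = Π_{2,1}(a, n). (Here 21a + 9 = C(7,2)·a + 9 = Σ_{2,1}(a,7).) -/
open Finset

/-- Sum of the edge multiplicities of the multigraph `w` inside the vertex set `X`
(edges are 2-element subsets of `Fin n`). -/
def edgeSum (n : ℕ) (w : Finset (Fin n) → ℕ) (X : Finset (Fin n)) : ℕ :=
  ∑ p ∈ X.powersetCard 2, w p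

/-- Product of the edge multiplicities of the multigraph `w` inside the vertex set `X`. -/
def edgeProd (n : ℕ) (w : Finset (Fin n) → ℕ) (X : Finset (Fin n)) : ℕ :=
  ∏ p ∈ X.powersetCard 2, w p

/-- The product-degree of the vertex `v` in the multigraph `w`. -/
def pdeg (n : ℕ) (w : Finset (Fin n) → ℕ) (v : Fin n) : ℕ :=
  ∏ u ∈ Finset.univ.erase v, w {u, v}

/-- `w` is an `(n,s,q)`-graph: every `s`-set of vertices spans at most `q` edges. -/
def IsF (n s q : ℕ) (w : Finset (Fin n) → ℕ) : Prop :=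
  ∀ X : Finset (Fin n), X.card = s → edgeSum n w X ≤ q

/-- `ex_Π(n,s,q)`: the maximum of the product of all edge multiplicities over
`(n,s,q)`-graphs. -/
noncomputable def exPi (n s q : ℕ) : ℕ :=
  sSup {P | ∃ w : Finset (Fin n) → ℕ, IsF n s q w ∧ P = edgeProd n w Finset.univ}

/-- Membership in the family `T_{r,d}(a,n)`: the vertex set can be partitioned into
parts `V_0, …, V_{r-1}` (given by a labelling `f`) so that edges inside `V_0` have
multiplicity `a - d`, edges inside `V_i` (`i ≥ 1`) have multiplicity `a`, and edges
between distinct parts have multiplicity `a + 1`. -/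
def InT (n r d a : ℕ) (w : Finset (Fin n) → ℕ) : Prop :=
  ∃ f : Fin n → ℕ, (∀ v, f v < r) ∧
    ∀ u v : Fin n, u ≠ v →
      w {u, v} = if f u = f v then (if f u = 0 then a - d else a) else a + 1

/-- `Σ_{r,d}(a,n)`: the maximum number of edges of a member of `T_{r,d}(a,n)`. -/
noncomputable def SigmaT (r d a n : ℕ) : ℕ :=
  sSup {e | ∃ w : Finset (Fin n) → ℕ, InT n r d a w ∧ e = edgeSum n w Finset.univ}

/-- `Π_{r,d}(a,n)`: the maximum product of edge multiplicities of a member of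
`T_{r,d}(a,n)`. -/
noncomputable def PiT (r d a n : ℕ) : ℕ :=
  sSup {P | ∃ w : Finset (Fin n) → ℕ, InT n r d a w ∧ P = edgeProd n w Finset.univ}

section PairSums

variable {V : Type*} [DecidableEq V]

/-- The sum of `f` over all ordered pairs of elements of `X`. -/
def pairSum {R : Type*} [AddCommMonoid R] (f : V → V → R) (X : Finset V) : R :=
  ∑ u ∈ X, ∑ v ∈ X, f u v

lemma pairSum_union {R : Type*} [CommRing R] {f : V → V → R} (hf : ∀ u v, f u v = f v u)
    {S Y : Finset V} (h : Disjoint S Y) :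
    pairSum f (S ∪ Y) = pairSum f S + pairSum f Y + 2 * ∑ y ∈ Y, ∑ s ∈ S, f y s := by
  have h1 : ∑ s ∈ S, ∑ y ∈ Y, f s y = ∑ y ∈ Y, ∑ s ∈ S, f y s := by
    rw [sum_comm]
    exact sum_congr rfl fun y _ => sum_congr rfl fun s _ => hf s y
  simp only [pairSum, sum_union h, sum_add_distrib]
  rw [h1]; ring

lemma pairSum_insert {R : Type*} [CommRing R] {f : V → V → R} (hf : ∀ u v, f u v = f v u)
    (h0 : ∀ u, f u u = 0) {v : V} {S : Finset V} (h : v ∉ S) :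
    pairSum f (insert v S) = pairSum f S + 2 * ∑ s ∈ S, f v s := by
  have := pairSum_union hf (disjoint_singleton_right.2 h)
  rw [union_comm, ← insert_eq] at this
  rw [this]
  simp [pairSum, h0]

lemma two_nsmul_sum_powersetCard_two {M : Type*} [AddCommMonoid M] (f : Finset V → M)
    (X : Finset V) :
    2 • ∑ p ∈ X.powersetCard 2, f p
      = pairSum (fun u v => if u = v then 0 else f {u, v}) X := by
  induction X using Finset.induction_on with
  | empty =>
    have h : powersetCard 2 (∅ : Finset V) = ∅ := powersetCard_eq_empty.2 (by simp)
    simp [pairSum, h]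
  | insert x X hx ih =>
    have hne : ∀ v ∈ X, x ≠ v := fun v hv h => hx (h ▸ hv)
    have h1 : ∑ p ∈ (X.powersetCard 1).image (insert x), f p = ∑ v ∈ X, f {x, v} := by
      rw [powersetCard_one, sum_image, sum_map]
      · rfl
      · intro s hs t ht hst
        simp only [coe_map, Set.mem_image, SetLike.mem_coe, Function.Embedding.coeFn_mk] at hs ht
        obtain ⟨u, hu, rfl⟩ := hs
        obtain ⟨v, hv, rfl⟩ := ht
        have : u ∈ ({x, v} : Finset V) := by
          have h : u ∈ ({x, u} : Finset V) := by simp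
          exact hst ▸ h
        simp only [mem_insert, mem_singleton] at this
        rcases this with h | h
        · exact absurd h.symm (hne u hu)
        · rw [h]
    have hd : Disjoint (X.powersetCard 2) ((X.powersetCard 1).image (insert x)) := by
      rw [disjoint_left]
      intro s hs hs'
      rw [mem_image] at hs'
      obtain ⟨t, -, rfl⟩ := hs'
      exact hx ((mem_powersetCard.1 hs).1 (mem_insert_self x t))
    rw [powersetCard_succ_insert hx, sum_union hd, h1, nsmul_add, ih]
    have h2 : ∑ v ∈ X, (if x = v then 0 else f {x, v}) = ∑ v ∈ X, f {x, v} :=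
      sum_congr rfl fun v hv => if_neg (hne v hv)
    have h3 : ∑ v ∈ X, (if v = x then 0 else f {v, x}) = ∑ v ∈ X, f {x, v} :=
      sum_congr rfl fun v hv => by rw [if_neg (hne v hv).symm, pair_comm]
    simp only [pairSum, sum_insert hx, if_true, sum_add_distrib, h2, h3, two_nsmul]
    abel

/-- The symmetric function which takes the value `c` inside `A`, `0` outside `A`, and `1` between
`A` and its complement. -/
def splitWeight {R : Type*} [Zero R] [One R] (c : R) (A : Finset V) (u v : V) : R :=
  if u = v then 0 else if u ∈ A then (if v ∈ A then c else 1) else if v ∈ A then 1 else 0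

lemma pairSum_splitWeight {R : Type*} [CommRing R] (c : R) (A X : Finset V) :
    pairSum (splitWeight c A) X
      = 2 * #(X ∩ A) * #(X \ A) + c * (#(X ∩ A) * (#(X ∩ A) - 1)) := by
  have hsymm : ∀ u v, splitWeight c A u v = splitWeight c A v u := by
    intro u v
    simp only [splitWeight, eq_comm (a := u)]
    split_ifs <;> rfl
  have hA : pairSum (splitWeight c A) (X ∩ A) = #(X ∩ A) * ((#(X ∩ A) - 1) * c) := by
    rw [← nsmul_eq_mul]
    refine sum_eq_card_nsmul fun u hu => ?_
    rw [← add_sum_erase _ _ hu, sum_eq_card_nsmul (b := c), nsmul_eq_mul,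
      cast_card_erase_of_mem hu]
    · simp [splitWeight]
    · intro v hv
      obtain ⟨hvu, hv⟩ := mem_erase.1 hv
      rw [splitWeight, if_neg hvu.symm, if_pos (mem_inter.1 hu).2, if_pos (mem_inter.1 hv).2]
  have hB : pairSum (splitWeight c A) (X \ A) = 0 :=
    sum_eq_zero fun u hu => sum_eq_zero fun v hv => by
      simp [splitWeight, (mem_sdiff.1 hu).2, (mem_sdiff.1 hv).2]
  have hAB : ∑ y ∈ X \ A, ∑ s ∈ X ∩ A, splitWeight c A y s = #(X \ A) * #(X ∩ A) := by
    rw [← nsmul_eq_mul]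
    refine sum_eq_card_nsmul fun u hu => ?_
    rw [sum_eq_card_nsmul (b := 1), nsmul_eq_mul, mul_one]
    intro v hv
    have huv : u ≠ v := fun h => (mem_sdiff.1 hu).2 (h ▸ (mem_inter.1 hv).2)
    rw [splitWeight, if_neg huv, if_neg (mem_sdiff.1 hu).2, if_pos (mem_inter.1 hv).2]
  have h := pairSum_union hsymm (disjoint_sdiff_inter X A).symm
  rw [union_comm, sdiff_union_inter, hA, hB, hAB] at h
  rw [h]
  ring

end PairSums

section OptVal

/-- Twice the largest value of `k (n - k) - b * (k choose 2)`: the normalised logarithm of the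
largest edge product in the family `T_{2,1}(a, n)`. -/
noncomputable def optVal (b : ℝ) (n : ℕ) : ℝ :=
  (range (n + 1)).sup' nonempty_range_add_one
    fun k => 2 * (k : ℝ) * (n - k) - b * (k * (k - 1))

lemma le_optVal (b : ℝ) {n k : ℕ} (h : k ≤ n) :
    2 * (k : ℝ) * (n - k) - b * (k * (k - 1)) ≤ optVal b n :=
  le_sup' (fun k : ℕ => 2 * (k : ℝ) * (n - k) - b * (k * (k - 1))) (mem_range_succ_iff.2 h)

lemma exists_eq_optVal (b : ℝ) (n : ℕ) :
    ∃ k ≤ n, optVal b n = 2 * (k : ℝ) * (n - k) - b * (k * (k - 1)) := by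
  obtain ⟨k, hk, h⟩ := exists_mem_eq_sup' (nonempty_range_add_one (n := n))
    fun k : ℕ => 2 * (k : ℝ) * (n - k) - b * (k * (k - 1))
  exact ⟨k, mem_range_succ_iff.1 hk, h⟩

lemma optVal_nonneg (b : ℝ) (n : ℕ) : 0 ≤ optVal b n := by
  simpa using le_optVal b (Nat.zero_le n)

variable {b x : ℝ}

lemma optVal_succ (hb : 0 ≤ b) (hx : x * (2 + b) = 1) (n : ℕ) :
    optVal b n + 2 * x * (n - 1) ≤ optVal b (n + 1) := by
  obtain ⟨k, hkn, hk⟩ := exists_eq_optVal b n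
  have hx0 : 0 < x := by
    by_contra! h
    nlinarith
  have h1 : x * (n - 1) ≤ k := by
    have h2 : (n : ℝ) - 1 ≤ (2 + b) * k := by
      rcases hkn.eq_or_lt with rfl | hlt
      · nlinarith [Nat.cast_nonneg (α := ℝ) k]
      · have := le_optVal b (Nat.succ_le_of_lt hlt)
        rw [hk] at this
        push_cast at this
        nlinarith
    calc x * (n - 1) ≤ x * ((2 + b) * k) := by gcongr
      _ = k := by rw [← mul_assoc, hx, one_mul]
  have := le_optVal b (hkn.trans (Nat.le_succ n))
  push_cast at this
  rw [hk]
  linarith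

lemma optVal_add (hb : 0 ≤ b) (hx : x * (2 + b) = 1) (n m : ℕ) :
    optVal b n + 2 * m * x * (n - 1) ≤ optVal b (n + m) := by
  have hx0 : 0 < x := by
    by_contra! h
    nlinarith
  induction m with
  | zero => simp
  | succ m ih =>
    have := optVal_succ hb hx (n + m)
    push_cast at this ⊢
    rw [← add_assoc]
    nlinarith [mul_nonneg hx0.le (Nat.cast_nonneg (α := ℝ) m)]

end OptVal
section Structure

variable {V : Type*} [DecidableEq V] {X : Finset V} {H L : V → V → Prop} [DecidableRel H]
  [DecidableRel L] {b x : ℝ}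

/-- If `H` is triangle-free and every 4-cycle of `H` has a diagonal in `L`, and the degrees
satisfy `d_H - b d_L ≥ x n - 7`, then a vertex of maximum `L`-degree has
`L`-degree close to `x n`. -/
lemma exists_card_filter_near (hb1 : 1 ≤ b) (hb2 : b ≤ 2) (hx : x * (2 + b) = 1)
    (hXn : 28 ≤ #X)
    (Hsymm : ∀ u v, H u v → H v u) (disj : ∀ u v, H u v → ¬ L u v)
    (tri : ∀ u ∈ X, ∀ v ∈ X, ∀ w ∈ X, H u v → H u w → ¬ H v w)
    (c4 : ∀ p ∈ X, ∀ q ∈ X, ∀ u ∈ X, ∀ v ∈ X, p ≠ q → u ≠ v →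
      H p u → H p v → H q u → H q v → L p q ∨ L u v)
    (hdeg : ∀ v ∈ X, x * #X - 7 ≤ #(X.filter (H v)) - b * #(X.filter (L v))) :
    ∃ v ∈ X, (∀ u ∈ X, #(X.filter (L u)) ≤ #(X.filter (L v))) ∧
      ((#(X.filter (L v)) : ℝ) - x * #X) ^ 2 ≤ 22 * #X := by
  have hne : X.Nonempty := card_pos.1 (by omega)
  obtain ⟨v, hv, hmax⟩ := exists_max_image X (fun u => #(X.filter (L u))) hne
  refine ⟨v, hv, hmax, ?_⟩
  set N := X.filter (H v) with hN
  set Λ := X.filter (L v) with hΛ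
  have hNX : N ⊆ X := filter_subset _ _
  have hΛX : Λ ⊆ X := filter_subset _ _
  have hx4 : 1 / 4 ≤ x := by nlinarith
  have hx3 : x ≤ 1 / 3 := by nlinarith
  have hdisj : Disjoint N Λ := by
    rw [disjoint_filter]
    exact fun u _ h => disj v u h
  have count : ∑ u ∈ N, #(X.filter (H u)) = ∑ z ∈ X, #(N.filter (H z)) := by
    have := sum_card_bipartiteAbove_eq_sum_card_bipartiteBelow (s := N) (t := X) H
    simp only [bipartiteAbove, bipartiteBelow] at this
    rw [this]
    refine sum_congr rfl fun z _ => congrArg _ (filter_congr fun u _ => ?_)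
    exact ⟨Hsymm _ _, Hsymm _ _⟩
  have bN : ∑ z ∈ N, #(N.filter (H z)) = 0 := by
    refine sum_eq_zero fun z hz => card_eq_zero.2 (filter_eq_empty_iff.2 fun u hu => ?_)
    exact tri v hv z (hNX hz) u (hNX hu) (mem_filter.1 hz).2 (mem_filter.1 hu).2
  have bΛ : ∑ z ∈ Λ, #(N.filter (H z)) ≤ #Λ * #N := by
    rw [← smul_eq_mul]
    exact sum_le_card_nsmul _ _ _ fun z _ => card_le_card (filter_subset _ _)
  have bR : ∑ z ∈ (X \ (N ∪ Λ)).erase v, #(N.filter (H z))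
      ≤ #((X \ (N ∪ Λ)).erase v) * (#Λ + 1) := by
    rw [← smul_eq_mul]
    refine sum_le_card_nsmul _ _ _ fun z hz => ?_
    simp only [mem_erase, mem_sdiff, mem_union, not_or] at hz
    obtain ⟨hzv, hzX, hzN, hzΛ⟩ := hz
    rcases (N.filter (H z)).eq_empty_or_nonempty with h0 | ⟨p, hp⟩
    · simp [h0]
    · have hpN := (mem_filter.1 hp).1
      have hpX := hNX hpN
      have hsub : (N.filter (H z)).erase p ⊆ X.filter (L p) := by
        intro q hq
        rw [mem_erase, mem_filter] at hq
        obtain ⟨hqp, hqN, hzq⟩ := hq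
        refine mem_filter.2 ⟨hNX hqN, ?_⟩
        refine (c4 v hv z hzX p hpX q (hNX hqN) hzv.symm hqp.symm (mem_filter.1 hpN).2
          (mem_filter.1 hqN).2 (mem_filter.1 hp).2 hzq).resolve_left fun h => hzΛ ?_
        exact mem_filter.2 ⟨hzX, h⟩
      have h1 := card_le_card hsub
      have h2 := hmax p hpX
      rw [card_erase_of_mem hp] at h1
      omega
  have bR' : ∑ z ∈ X \ (N ∪ Λ), #(N.filter (H z)) ≤ #N + #(X \ (N ∪ Λ)) * (#Λ + 1) := by
    have h1 : #((X \ (N ∪ Λ)).erase v) ≤ #(X \ (N ∪ Λ)) := card_le_card (erase_subset _ _)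
    have h2 := Nat.mul_le_mul_right (#Λ + 1) h1
    by_cases h : v ∈ X \ (N ∪ Λ)
    · rw [← add_sum_erase _ _ h]
      have : #(N.filter (H v)) ≤ #N := card_le_card (filter_subset _ _)
      omega
    · rw [erase_eq_of_notMem h] at bR
      omega
  have hcard : #(X \ (N ∪ Λ)) + (#N + #Λ) = #X := by
    rw [← card_union_of_disjoint hdisj, card_sdiff_add_card_eq_card (union_subset hNX hΛX)]
  have upper : ∑ u ∈ N, #(X.filter (H u)) ≤
      #Λ * #N + (#N + #(X \ (N ∪ Λ)) * (#Λ + 1)) := by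
    rw [count, ← sum_sdiff (union_subset hNX hΛX), sum_union hdisj, bN]
    omega
  have lower : (#N : ℝ) * (x * #X - 7) ≤ ∑ u ∈ N, (#(X.filter (H u)) : ℝ) := by
    rw [← nsmul_eq_mul]
    refine card_nsmul_le_sum _ _ _ fun u hu => ?_
    have := hdeg u (hNX hu)
    have : 0 ≤ b * #(X.filter (L u)) := by positivity
    linarith
  have hd := hdeg v hv
  rw [← hN, ← hΛ] at hd
  have hn : (28 : ℝ) ≤ #X := by exact_mod_cast hXn
  have upper' : ∑ u ∈ N, (#(X.filter (H u)) : ℝ) ≤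
      #Λ * #N + (#N + #(X \ (N ∪ Λ)) * (#Λ + 1)) := by exact_mod_cast upper
  have hcard' : (#(X \ (N ∪ Λ)) : ℝ) = #X - #N - #Λ := by
    rw [← hcard]; push_cast; ring
  rw [hcard'] at upper'
  have ht0 : (0 : ℝ) ≤ #Λ := by positivity
  have hd0 : (0 : ℝ) ≤ #N := by positivity
  have htn : (#Λ : ℝ) ≤ #X := by exact_mod_cast card_le_card hΛX
  have hxn : 0 ≤ x * #X - 7 := by nlinarith
  generalize (#X : ℝ) = n at *
  generalize (#Λ : ℝ) = t at *
  generalize (#N : ℝ) = d at *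
  have key : (x * n - 7 + b * t) * (x * n - 7) ≤ t * (n - t) + n := by
    have : (x * n - 7 + b * t) * (x * n - 7) ≤ d * (x * n - 7) :=
      mul_le_mul_of_nonneg_right (by linarith) hxn
    nlinarith
  have e1 : b * x = 1 - 2 * x := by linarith
  have e2 : b * t * (x * n) = t * n - 2 * x * t * n := by
    linear_combination t * n * e1
  nlinarith

set_option maxHeartbeats 800000 in
/-- Large vertex sets in which all degrees `d_H - b d_L` are nearly extremal split into a clique
of `L` and an independent set of `H`. -/
lemma exists_partition (hb1 : 1 ≤ b) (hb2 : b ≤ 2) (hx : x * (2 + b) = 1)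
    (hXn : 1000000 ≤ #X)
    (Hsymm : ∀ u v, H u v → H v u) (disj : ∀ u v, H u v → ¬ L u v)
    (tri : ∀ u ∈ X, ∀ v ∈ X, ∀ w ∈ X, H u v → H u w → ¬ H v w)
    (c4 : ∀ p ∈ X, ∀ q ∈ X, ∀ u ∈ X, ∀ v ∈ X, p ≠ q → u ≠ v →
      H p u → H p v → H q u → H q v → L p q ∨ L u v)
    (hdeg : ∀ v ∈ X, x * #X - 7 ≤ #(X.filter (H v)) - b * #(X.filter (L v))) :
    ∃ A ⊆ X, (∀ u ∈ A, ∀ v ∈ A, u ≠ v → L u v) ∧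
      ∀ u ∈ X \ A, ∀ v ∈ X \ A, ¬ H u v := by
  obtain ⟨v, hv, hmax, hnear⟩ :=
    exists_card_filter_near hb1 hb2 hx (by omega) Hsymm disj tri c4 hdeg
  have hx4 : 1 / 4 ≤ x := by nlinarith
  have hx3 : x ≤ 1 / 3 := by nlinarith
  have hxb : x * b = 1 - 2 * x := by linarith
  have hn : (1000000 : ℝ) ≤ #X := by exact_mod_cast hXn
  obtain ⟨E, hE⟩ : ∃ E : ℝ, (#X : ℝ) = 200 * E := ⟨#X / 200, by ring⟩
  have hE0 : 5000 ≤ E := by linarith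
  rw [hE] at hnear
  obtain ⟨ht1, ht2⟩ : -E ≤ (#(X.filter (L v)) : ℝ) - x * (200 * E) ∧
      (#(X.filter (L v)) : ℝ) - x * (200 * E) ≤ E :=
    abs_le_of_sq_le_sq' (by nlinarith) (by linarith)
  rw [hE] at hdeg
  set N := X.filter (H v) with hN
  set M := X \ N with hM
  have hNX : N ⊆ X := filter_subset _ _
  have hMX : M ⊆ X := sdiff_subset
  have hcardMN : (#M : ℝ) + #N = 200 * E := by
    rw [← hE]; exact_mod_cast card_sdiff_add_card_eq_card hNX
  have hxE : 50 * E ≤ x * (200 * E) := by nlinarith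
  have hxE' : x * (200 * E) ≤ 67 * E := by nlinarith
  have hbxE : b * (x * (200 * E)) = 200 * E - 2 * (x * (200 * E)) := by
    linear_combination (200 * E) * hxb
  -- sizes of `N` and `M`
  have hNlow : 200 * E - x * (200 * E) - 3 * E ≤ #N := by
    have h1 := hdeg v hv
    have h2 : b * (x * (200 * E) - E) ≤ b * #(X.filter (L v)) := by gcongr; linarith
    nlinarith
  have hNup : (#N : ℝ) ≤ 200 * E - x * (200 * E) + E := by
    have hdis : Disjoint N (X.filter (L v)) := by
      rw [disjoint_filter]
      exact fun u _ h => disj v u h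
    have h1 := card_le_card (union_subset hNX (filter_subset (L v) X))
    rw [card_union_of_disjoint hdis] at h1
    have h2 : (#N : ℝ) + #(X.filter (L v)) ≤ 200 * E := by rw [← hE]; exact_mod_cast h1
    linarith
  generalize hy : x * (200 * E) = y at *
  -- neighbourhoods of vertices of `N`
  have hNM : ∀ u ∈ N, X.filter (H u) ⊆ M := by
    intro u hu w hw
    refine mem_sdiff.2 ⟨(mem_filter.1 hw).1, fun hwN => ?_⟩
    exact tri v hv u (hNX hu) w (hNX hwN) (mem_filter.1 hu).2 (mem_filter.1 hwN).2
      (mem_filter.1 hw).2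
  have hNdeg : ∀ u ∈ N, y - 7 ≤ #(X.filter (H u)) := by
    intro u hu
    have h1 := hdeg u (hNX hu)
    have : 0 ≤ b * #(X.filter (L u)) := by positivity
    linarith
  have hNL : ∀ u ∈ N, (#(X.filter (L u)) : ℝ) ≤ 4 * E := by
    intro u hu
    have h1 := hdeg u (hNX hu)
    have h2 : (#(X.filter (H u)) : ℝ) ≤ #M := by exact_mod_cast card_le_card (hNM u hu)
    have h3 : (#(X.filter (L u)) : ℝ) ≤ b * #(X.filter (L u)) :=
      le_mul_of_one_le_left (by positivity) hb1
    linarith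
  have hNmiss : ∀ u ∈ N, (#(M.filter (fun w => ¬ H u w)) : ℝ) ≤ 4 * E := by
    intro u hu
    have h1 := card_filter_add_card_filter_not (s := M) (H u)
    have h2 : X.filter (H u) ⊆ M.filter (H u) := fun w hw =>
      mem_filter.2 ⟨hNM u hu hw, (mem_filter.1 hw).2⟩
    have h3 : (#(X.filter (H u)) : ℝ) ≤ #(M.filter (H u)) := by
      exact_mod_cast card_le_card h2
    have h4 : (#(M.filter (H u)) : ℝ) + #(M.filter (fun w => ¬ H u w)) = #M := by
      exact_mod_cast h1
    have := hNdeg u hu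
    linarith
  -- two vertices not in relation `L` have few common neighbours in `N`
  have hclique : ∀ w ∈ X, ∀ w' ∈ X, w ≠ w' → ¬ L w w' →
      (#((N.filter (H w)).filter (H w')) : ℝ) ≤ 5 * E := by
    intro w hw w' hw' hne hL
    rcases ((N.filter (H w)).filter (H w')).eq_empty_or_nonempty with h0 | ⟨p, hp⟩
    · rw [h0]; simp; linarith
    · have hsub : ((N.filter (H w)).filter (H w')).erase p ⊆ X.filter (L p) := by
        intro q hq
        simp only [mem_erase, mem_filter] at hq hp
        exact mem_filter.2 ⟨hNX hq.2.1.1, (c4 w hw w' hw' p (hNX hp.1.1) q (hNX hq.2.1.1) hne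
          hq.1.symm hp.1.2 hq.2.1.2 hp.2 hq.2.2).resolve_left hL⟩
      have h1 := card_le_card hsub
      have h2 := card_erase_add_one hp
      have h3 : (#((N.filter (H w)).filter (H w')) : ℝ) ≤ #(X.filter (L p)) + 1 := by
        exact_mod_cast (by omega)
      have := hNL p (mem_filter.1 (mem_filter.1 hp).1).1
      linarith
  -- vertices of `M` with many neighbours in `N` have almost all of `N` as neighbours
  have hlarge : ∀ w ∈ M, 10 * E ≤ #(N.filter (H w)) →
      200 * E - y - 31 * E ≤ #(N.filter (H w)) := by
    intro w hw h10
    have hwX := hMX hw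
    set D := N.filter (H w) with hD
    set B := (M.erase w).filter (fun w' => ¬ L w w') with hB
    have hdc : ∑ u ∈ D, #(B.filter (fun w' => ¬ H u w'))
        = ∑ w' ∈ B, #(D.filter (fun u => ¬ H u w')) := by
      simpa only [bipartiteAbove, bipartiteBelow] using
        sum_card_bipartiteAbove_eq_sum_card_bipartiteBelow (s := D) (t := B)
          (fun u w' => ¬ H u w')
    have hup : ∑ u ∈ D, (#(B.filter (fun w' => ¬ H u w')) : ℝ) ≤ #D * (4 * E) := by
      rw [← nsmul_eq_mul]
      refine sum_le_card_nsmul _ _ _ fun u hu => (Nat.cast_le.2 (card_le_card ?_)).trans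
        (hNmiss u (mem_filter.1 hu).1)
      exact filter_subset_filter _ ((filter_subset _ _).trans (erase_subset _ _))
    have hlow : #B * ((#D : ℝ) - 5 * E) ≤ ∑ w' ∈ B, (#(D.filter (fun u => ¬ H u w')) : ℝ) := by
      rw [← nsmul_eq_mul]
      refine card_nsmul_le_sum _ _ _ fun w' hw' => ?_
      obtain ⟨hw1, hwL⟩ := mem_filter.1 hw'
      obtain ⟨hne, hwM⟩ := mem_erase.1 hw1
      have h1 := hclique w hwX w' (hMX hwM) hne.symm hwL
      have h2 := card_filter_add_card_filter_not (s := D) (H w')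
      have h3 : (#(D.filter (H w')) : ℝ) + #(D.filter (fun u => ¬ H w' u)) = #D := by
        exact_mod_cast h2
      have h4 : D.filter (fun u => ¬ H w' u) = D.filter (fun u => ¬ H u w') :=
        filter_congr fun u _ => not_congr ⟨Hsymm _ _, Hsymm _ _⟩
      rw [h4] at h3
      linarith
    have hdc' : ∑ u ∈ D, (#(B.filter (fun w' => ¬ H u w')) : ℝ)
        = ∑ w' ∈ B, (#(D.filter (fun u => ¬ H u w')) : ℝ) := by exact_mod_cast hdc
    have hBcard : (#B : ℝ) ≤ 8 * E := by
      by_contra! hlt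
      have : 8 * E * (#D - 5 * E) < #B * ((#D : ℝ) - 5 * E) :=
        mul_lt_mul_of_pos_right hlt (by linarith)
      nlinarith
    have hsplit : (#(M.filter (L w)) : ℝ) + #B + 1 ≥ #M := by
      have h1 := card_filter_add_card_filter_not (s := M.erase w) (L w)
      rw [← hB] at h1
      have h2 := card_erase_add_one hw
      have h3 : #((M.erase w).filter (L w)) ≤ #(M.filter (L w)) :=
        card_le_card (filter_subset_filter _ (erase_subset _ _))
      exact_mod_cast (by omega : #M ≤ #(M.filter (L w)) + #B + 1)
    have hLdeg : y - 10 * E ≤ #(X.filter (L w)) := by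
      have h1 : (#(M.filter (L w)) : ℝ) ≤ #(X.filter (L w)) := by
        exact_mod_cast card_le_card (filter_subset_filter _ hMX)
      linarith
    have hHdeg : 200 * E - y - 21 * E ≤ #(X.filter (H w)) := by
      have h1 := hdeg w hwX
      have h2 : b * (y - 10 * E) ≤ b * #(X.filter (L w)) := by gcongr
      have h3 : b * E ≤ 2 * E := by gcongr
      linarith
    have hMH : (#(M.filter (H w)) : ℝ) ≤ 9 * E := by
      have hdis : Disjoint (M.filter (H w)) (M.filter (L w)) := by
        rw [disjoint_filter]
        exact fun u _ h => disj w u h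
      have h1 := card_le_card
        (union_subset (filter_subset (H w) M) (filter_subset (L w) M))
      rw [card_union_of_disjoint hdis] at h1
      have h2 : (#(M.filter (H w)) : ℝ) + #(M.filter (L w)) ≤ #M := by exact_mod_cast h1
      linarith
    have hHsplit : (#(X.filter (H w)) : ℝ) ≤ #(M.filter (H w)) + #D := by
      have : X.filter (H w) ⊆ M.filter (H w) ∪ D := by
        rw [hD, hM, ← filter_union, sdiff_union_of_subset hNX]
      exact_mod_cast (card_le_card this).trans (card_union_le _ _)
    linarith
  refine ⟨M.filter fun w => 10 * E ≤ #(N.filter (H w)), (filter_subset _ _).trans hMX, ?_, ?_⟩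
  · intro u hu w hw hne
    by_contra hL
    obtain ⟨huM, hu10⟩ := mem_filter.1 hu
    obtain ⟨hwM, hw10⟩ := mem_filter.1 hw
    have h1 := hclique u (hMX huM) w (hMX hwM) hne hL
    have h2 := hlarge u huM hu10
    have h3 := hlarge w hwM hw10
    have h4 := card_union_add_card_inter (N.filter (H u)) (N.filter (H w))
    have h5 : #(N.filter (H u) ∪ N.filter (H w)) ≤ #N :=
      card_le_card (union_subset (filter_subset _ _) (filter_subset _ _))
    have h6 : N.filter (H u) ∩ N.filter (H w) = (N.filter (H u)).filter (H w) := by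
      ext z; simp only [mem_inter, mem_filter]; tauto
    rw [h6] at h4
    have h7 : (#(N.filter (H u)) : ℝ) + #(N.filter (H w))
        ≤ #N + #((N.filter (H u)).filter (H w)) := by exact_mod_cast (by omega)
    linarith
  · have hhalf : ∀ u ∈ X \ M.filter (fun w => 10 * E ≤ #(N.filter (H w))),
        (#M : ℝ) < 2 * #(M.filter (H u)) := by
      intro u hu
      obtain ⟨huX, huA⟩ := mem_sdiff.1 hu
      by_cases huN : u ∈ N
      · have h1 := hNdeg u huN
        have h2 : X.filter (H u) ⊆ M.filter (H u) := fun w hw =>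
          mem_filter.2 ⟨hNM u huN hw, (mem_filter.1 hw).2⟩
        have h3 : (#(X.filter (H u)) : ℝ) ≤ #(M.filter (H u)) := by
          exact_mod_cast card_le_card h2
        linarith
      · have huM : u ∈ M := mem_sdiff.2 ⟨huX, huN⟩
        have h1 : (#(N.filter (H u)) : ℝ) < 10 * E := by
          by_contra! h
          exact huA (mem_filter.2 ⟨huM, h⟩)
        have h2 := hdeg u huX
        have h3 : 0 ≤ b * #(X.filter (L u)) := by positivity
        have h4 : (#(X.filter (H u)) : ℝ) ≤ #(M.filter (H u)) + #(N.filter (H u)) := by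
          have : X.filter (H u) ⊆ M.filter (H u) ∪ N.filter (H u) := by
            rw [hM, ← filter_union, sdiff_union_of_subset hNX]
          exact_mod_cast (card_le_card this).trans (card_union_le _ _)
        linarith
    intro u hu w hw huw
    have h1 := hhalf u hu
    have h2 := hhalf w hw
    have h3 : Disjoint (M.filter (H u)) (M.filter (H w)) := by
      rw [disjoint_filter]
      exact fun z hz huz hwz => tri u (mem_sdiff.1 hu).1 w (mem_sdiff.1 hw).1 z (hMX hz) huw huz hwz
    have h4 := card_le_card
      (union_subset (filter_subset (H u) M) (filter_subset (H w) M))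
    rw [card_union_of_disjoint h3] at h4
    have h5 : (#(M.filter (H u)) : ℝ) + #(M.filter (H w)) ≤ #M := by exact_mod_cast h4
    linarith

end Structure

section Descent

variable {V : Type*} [DecidableEq V] {X : Finset V} {ex : V → V → ℤ} {val : V → V → ℝ} {b x : ℝ}

lemma even_pairSum (esymm : ∀ u v, ex u v = ex v u) (ediag : ∀ u, ex u u = 0) (S : Finset V) :
    Even (pairSum ex S) := by
  induction S using Finset.induction_on with
  | empty => simp [pairSum]
  | insert v S hv ih =>
    rw [pairSum_insert esymm ediag hv]
    exact ih.add (even_two_mul _)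

/-- Averaging over vertex deletions. -/
lemma pairSum_le_of_card_seven (esymm : ∀ u v, ex u v = ex v u) (ediag : ∀ u, ex u u = 0)
    (m : ℕ) (hm : 7 ≤ m) : ∀ X : Finset V, (∀ Z ⊆ X, #Z = 7 → pairSum ex Z ≤ 18) → #X = m →
      7 * pairSum ex X ≤ 3 * (m * (m - 1)) := by
  induction m, hm using Nat.le_induction with
  | base =>
    intro X h hX
    have := h X subset_rfl hX
    norm_num
    linarith
  | succ m hm ih =>
    intro X h hX
    have h1 : ∀ v ∈ X, 7 * pairSum ex (X.erase v) ≤ 3 * (m * (m - 1)) := fun v hv =>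
      ih _ (fun Z hZ => h Z (hZ.trans (erase_subset _ _))) (by rw [card_erase_of_mem hv, hX]; rfl)
    have h2 : ∀ v ∈ X, pairSum ex (X.erase v) = pairSum ex X - 2 * ∑ s ∈ X, ex v s := by
      intro v hv
      have := pairSum_insert esymm ediag (notMem_erase v X)
      rw [insert_erase hv] at this
      rw [this, ← add_sum_erase _ _ hv, ediag]
      ring
    have h3 := sum_le_card_nsmul _ _ _ h1
    rw [← mul_sum, sum_congr rfl h2, sum_sub_distrib, ← mul_sum, sum_const, hX] at h3
    change 7 * (_ - 2 * pairSum ex X) ≤ _ at h3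
    simp only [nsmul_eq_mul] at h3
    push_cast at h3 ⊢
    have hm' : (7 : ℤ) ≤ m := by exact_mod_cast hm
    nlinarith

/-- A set with more than `p` excess edges, in a multigraph whose sets with one more vertex have
excess at most `q`, sends little weight to the outside. -/
lemma pairSum_le_of_heavy (esymm : ∀ u v, ex u v = ex v u) (ediag : ∀ u, ex u u = 0)
    (vsymm : ∀ u v, val u v = val v u) (hve : ∀ u v, val u v ≤ ex u v)
    {S : Finset V} (hSX : S ⊆ X) (hlt : #S < #X) {p q : ℤ}
    (hq : ∀ Z ⊆ X, #Z = #S + 1 → pairSum ex Z ≤ 2 * q) (hp : 2 * p < pairSum ex S) :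
    pairSum val X ≤ pairSum val (X \ S) + (2 * p + 2) + 2 * (#X - #S) * (q - p - 1) := by
  obtain ⟨r, hr⟩ := even_pairSum esymm ediag S
  have hout : ∀ v ∈ X \ S, ∑ s ∈ S, val v s ≤ (q : ℝ) - r := by
    intro v hv
    obtain ⟨hvX, hvS⟩ := mem_sdiff.1 hv
    have h1 := hq (insert v S) (insert_subset hvX hSX) (card_insert_of_notMem hvS)
    rw [pairSum_insert esymm ediag hvS] at h1
    have h2 : ∑ s ∈ S, ex v s ≤ q - r := by omega
    calc ∑ s ∈ S, val v s ≤ ∑ s ∈ S, (ex v s : ℝ) := sum_le_sum fun s _ => hve v s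
      _ ≤ (q : ℝ) - r := by exact_mod_cast h2
  have hS : pairSum val S ≤ 2 * r := by
    calc pairSum val S ≤ ∑ u ∈ S, ∑ v ∈ S, (ex u v : ℝ) :=
        sum_le_sum fun u _ => sum_le_sum fun v _ => hve u v
      _ = ((pairSum ex S : ℤ) : ℝ) := by simp [pairSum]
      _ = 2 * r := by rw [hr]; push_cast; ring
  have hsum := sum_le_card_nsmul _ _ _ hout
  rw [nsmul_eq_mul] at hsum
  have hcard : (#(X \ S) : ℝ) = #X - #S := by
    rw [← card_sdiff_add_card_eq_card hSX]; push_cast; ring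
  have hX : pairSum val X = pairSum val S + pairSum val (X \ S)
      + 2 * ∑ y ∈ X \ S, ∑ s ∈ S, val y s := by
    rw [← pairSum_union vsymm disjoint_sdiff, union_sdiff_of_subset hSX]
  have hpr : (p : ℝ) + 1 ≤ r := by exact_mod_cast (by omega : p + 1 ≤ r)
  have hlt' : (#S : ℝ) + 1 ≤ #X := by exact_mod_cast hlt
  rw [hcard] at hsum
  rw [hX]
  nlinarith

/-- Removing a few vertices from `X` yields a set whose value is closer to, or further above,
the extremal value for its size. -/
def Improvable (val : V → V → ℝ) (b : ℝ) (X : Finset V) : Prop :=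
  ∃ Y ⊆ X, 7 ≤ #Y ∧ #Y < #X ∧ #X ≤ #Y + 6 ∧
    pairSum val X - optVal b #X + 6 ≤ pairSum val Y - optVal b #Y

lemma improvable_of_heavy (hb : 0 ≤ b) (hx : x * (2 + b) = 1)
    (esymm : ∀ u v, ex u v = ex v u) (ediag : ∀ u, ex u u = 0)
    (vsymm : ∀ u v, val u v = val v u) (hve : ∀ u v, val u v ≤ ex u v)
    (hXn : 1000000 ≤ #X) {S : Finset V} (hSX : S ⊆ X) {m : ℕ} (hm0 : 0 < m) (hm : m ≤ 6)
    (hS : #S = m) {p q : ℤ} (hp7 : p ≤ 7) (hj0 : 0 ≤ q - p - 1) (hj1 : q - p - 1 ≤ 1)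
    (hmx : (q - p - 1 : ℝ) + 1 / 15 ≤ m * x)
    (hq : ∀ Z ⊆ X, #Z = m + 1 → pairSum ex Z ≤ 2 * q) (hp : 2 * p < pairSum ex S) :
    Improvable val b X := by
  subst hS
  have hc := card_sdiff_add_card_eq_card hSX
  have h1 := pairSum_le_of_heavy esymm ediag vsymm hve hSX (by omega) hq hp
  have h2 := optVal_add hb hx #(X \ S) #S
  have hcard : (#(X \ S) : ℝ) = #X - #S := by
    rw [← hc]; push_cast; ring
  refine ⟨X \ S, sdiff_subset, by omega, by omega, by omega, ?_⟩
  rw [hc, hcard] at h2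
  have hn : (1000000 : ℝ) ≤ #X := by exact_mod_cast hXn
  have hS6 : (#S : ℝ) ≤ 6 := by exact_mod_cast hm
  have hS0 : (0 : ℝ) ≤ #S := by positivity
  have hp7' : (p : ℝ) ≤ 7 := by exact_mod_cast hp7
  have hj0' : (0 : ℝ) ≤ q - p - 1 := by exact_mod_cast hj0
  have hj1' : (q - p - 1 : ℝ) ≤ 1 := by exact_mod_cast hj1
  generalize (q - p - 1 : ℝ) = j at *
  have h3 : (j + 1 / 15) * (#X - #S - 1) ≤ #S * x * (#X - #S - 1) :=
    mul_le_mul_of_nonneg_right hmx (by linarith)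
  nlinarith

lemma improvable_of_degree (hb : 0 ≤ b) (hx : x * (2 + b) = 1)
    (vsymm : ∀ u v, val u v = val v u) (vdiag : ∀ u, val u u = 0)
    (hXn : 1000000 ≤ #X) {v : V} (hv : v ∈ X) (hdeg : ∑ s ∈ X, val v s < x * #X - 7) :
    Improvable val b X := by
  have hc := card_erase_add_one hv
  have h1 := pairSum_insert vsymm vdiag (notMem_erase v X)
  rw [insert_erase hv] at h1
  rw [← add_sum_erase _ _ hv, vdiag, zero_add] at hdeg
  have h2 := optVal_succ hb hx #(X.erase v)
  have hcard : (#(X.erase v) : ℝ) = #X - 1 := by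
    rw [← hc]; push_cast; ring
  rw [hc, hcard] at h2
  refine ⟨X.erase v, erase_subset _ _, by omega, by omega, by omega, ?_⟩
  have hx3 : x ≤ 1 / 2 := by
    by_contra! h
    nlinarith
  linarith

lemma pairSum_le_optVal_of_partition (vdiag : ∀ u, val u u = 0)
    {A : Finset V} (hAX : A ⊆ X) (hX1 : ∀ u ∈ X, ∀ v ∈ X, val u v ≤ 1)
    (hA : ∀ u ∈ A, ∀ v ∈ A, u ≠ v → val u v ≤ -b)
    (hB : ∀ u ∈ X \ A, ∀ v ∈ X \ A, val u v ≤ 0) :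
    pairSum val X ≤ optVal b #X := by
  have h1 : pairSum val X ≤ pairSum (splitWeight (-b) A) X := by
    refine sum_le_sum fun u hu => sum_le_sum fun v hv => ?_
    rw [splitWeight]
    split_ifs with huv huA hvA hvA
    · rw [huv, vdiag]
    · exact hA u huA v hvA huv
    · exact hX1 u hu v hv
    · exact hX1 u hu v hv
    · exact hB u (mem_sdiff.2 ⟨hu, huA⟩) v (mem_sdiff.2 ⟨hv, hvA⟩)
  have h2 := le_optVal b (card_le_card hAX)
  rw [pairSum_splitWeight, inter_eq_right.2 hAX, cast_card_sdiff hAX] at h1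
  linarith

lemma pairSum_pair (esymm : ∀ u v, ex u v = ex v u) (ediag : ∀ u, ex u u = 0) {u v : V}
    (huv : u ≠ v) : pairSum ex {u, v} = 2 * ex u v := by
  rw [pairSum_insert esymm ediag (by simpa using huv)]
  simp [pairSum, ediag]

lemma pairSum_triple (esymm : ∀ u v, ex u v = ex v u) (ediag : ∀ u, ex u u = 0) {u v w : V}
    (huv : u ≠ v) (huw : u ≠ w) (hvw : v ≠ w) :
    pairSum ex {u, v, w} = 2 * (ex u v + ex u w + ex v w) := by
  rw [pairSum_insert esymm ediag (by simp [huv, huw]), pairSum_pair esymm ediag hvw,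
    sum_pair hvw]
  ring

lemma pairSum_quadruple (esymm : ∀ u v, ex u v = ex v u) (ediag : ∀ u, ex u u = 0)
    {p q u v : V} (hpq : p ≠ q) (hpu : p ≠ u) (hpv : p ≠ v) (hqu : q ≠ u) (hqv : q ≠ v)
    (huv : u ≠ v) :
    pairSum ex {p, q, u, v} = 2 * (ex p q + ex p u + ex p v + ex q u + ex q v + ex u v) := by
  rw [pairSum_insert esymm ediag (by simp [hpq, hpu, hpv]),
    pairSum_triple esymm ediag hqu hqv huv, sum_insert (by simp [hqu, hqv]), sum_pair huv]
  ring

lemma pairSum_le_or_improvable (hb1 : 1 ≤ b) (hb2 : b ≤ 7 / 4)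
    (esymm : ∀ u v, ex u v = ex v u) (ediag : ∀ u, ex u u = 0)
    (vsymm : ∀ u v, val u v = val v u) (vdiag : ∀ u, val u u = 0)
    (hve : ∀ u v, val u v ≤ ex u v) (hneg : ∀ u v, ex u v ≤ -1 → val u v ≤ -b)
    (h7 : ∀ Z ⊆ X, #Z = 7 → pairSum ex Z ≤ 18) (hXn : 1000000 ≤ #X) :
    pairSum val X ≤ optVal b #X ∨ Improvable val b X := by
  rw [or_iff_not_imp_right]
  intro hI
  obtain ⟨x, hx⟩ : ∃ x : ℝ, x * (2 + b) = 1 := ⟨(2 + b)⁻¹, inv_mul_cancel₀ (by linarith)⟩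
  have hb0 : 0 ≤ b := by linarith
  have hx4 : 4 / 15 ≤ x := by nlinarith
  have h6 : ∀ S ⊆ X, #S = 6 → pairSum ex S ≤ 2 * 7 := by
    intro S hSX hS
    by_contra! h
    exact hI (improvable_of_heavy hb0 hx esymm ediag vsymm hve hXn hSX (by norm_num) (by norm_num)
      hS (p := 7) (q := 9) (by norm_num) (by norm_num) (by norm_num) (by norm_num; linarith) h7 h)
  have h5 : ∀ S ⊆ X, #S = 5 → pairSum ex S ≤ 2 * 5 := by
    intro S hSX hS
    by_contra! h
    exact hI (improvable_of_heavy hb0 hx esymm ediag vsymm hve hXn hSX (by norm_num) (by norm_num)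
      hS (p := 5) (q := 7) (by norm_num) (by norm_num) (by norm_num) (by norm_num; linarith) h6 h)
  have h4 : ∀ S ⊆ X, #S = 4 → pairSum ex S ≤ 2 * 3 := by
    intro S hSX hS
    by_contra! h
    exact hI (improvable_of_heavy hb0 hx esymm ediag vsymm hve hXn hSX (by norm_num) (by norm_num)
      hS (p := 3) (q := 5) (by norm_num) (by norm_num) (by norm_num) (by norm_num; linarith) h5 h)
  have h3 : ∀ S ⊆ X, #S = 3 → pairSum ex S ≤ 2 * 2 := by
    intro S hSX hS
    by_contra! h
    exact hI (improvable_of_heavy hb0 hx esymm ediag vsymm hve hXn hSX (by norm_num) (by norm_num)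
      hS (p := 2) (q := 3) (by norm_num) (by norm_num) (by norm_num) (by norm_num; linarith) h4 h)
  have h2 : ∀ S ⊆ X, #S = 2 → pairSum ex S ≤ 2 * 1 := by
    intro S hSX hS
    by_contra! h
    exact hI (improvable_of_heavy hb0 hx esymm ediag vsymm hve hXn hSX (by norm_num) (by norm_num)
      hS (p := 1) (q := 2) (by norm_num) (by norm_num) (by norm_num) (by norm_num; linarith) h3 h)
  have hle1 : ∀ u ∈ X, ∀ v ∈ X, ex u v ≤ 1 := by
    intro u hu v hv
    rcases eq_or_ne u v with rfl | huv
    · simp [ediag]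
    · have := h2 {u, v} (by simp [insert_subset_iff, hu, hv]) (card_pair huv)
      rw [pairSum_pair esymm ediag huv] at this
      linarith
  have hne : ∀ {u v}, ex u v = 1 → u ≠ v := by
    rintro u v h rfl
    rw [ediag] at h
    exact absurd h (by norm_num)
  have tri : ∀ u ∈ X, ∀ v ∈ X, ∀ w ∈ X, ex u v = 1 → ex u w = 1 → ¬ ex v w = 1 := by
    intro u hu v hv w hw huv huw hvw
    have := h3 {u, v, w} (by simp [insert_subset_iff, hu, hv, hw])
      (card_eq_three.2 ⟨u, v, w, hne huv, hne huw, hne hvw, rfl⟩)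
    rw [pairSum_triple esymm ediag (hne huv) (hne huw) (hne hvw)] at this
    linarith
  have c4 : ∀ p ∈ X, ∀ q ∈ X, ∀ u ∈ X, ∀ v ∈ X, p ≠ q → u ≠ v → ex p u = 1 → ex p v = 1 →
      ex q u = 1 → ex q v = 1 → ex p q ≤ -1 ∨ ex u v ≤ -1 := by
    intro p hp q hq u hu v hv hpq huv hpu hpv hqu hqv
    have := h4 {p, q, u, v} (by simp [insert_subset_iff, hp, hq, hu, hv])
      (by rw [card_insert_of_notMem (by simp [hpq, hne hpu, hne hpv]),
        card_eq_three.2 ⟨q, u, v, hne hqu, hne hqv, huv, rfl⟩])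
    rw [pairSum_quadruple esymm ediag hpq (hne hpu) (hne hpv) (hne hqu) (hne hqv) huv] at this
    omega
  have hdeg : ∀ v ∈ X, x * #X - 7 ≤
      #(X.filter (fun u => ex v u = 1)) - b * #(X.filter (fun u => ex v u ≤ -1)) := by
    intro v hv
    by_contra! h
    refine hI (improvable_of_degree hb0 hx vsymm vdiag hXn hv (lt_of_le_of_lt ?_ h))
    rw [← sum_boole, ← sum_boole, mul_sum, ← sum_sub_distrib]
    refine sum_le_sum fun u hu => ?_
    have h1 := hle1 v hv u hu
    rcases lt_trichotomy (ex v u) 0 with h0 | h0 | h0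
    · have h0' : ex v u ≤ -1 := by omega
      have := hneg v u h0'
      rw [if_neg (by omega), if_pos h0']
      linarith
    · have := hve v u
      rw [if_neg (by omega), if_neg (by omega)]
      rw [h0] at this
      simpa using this
    · have h0' : ex v u = 1 := by omega
      have := hve v u
      rw [if_pos h0', if_neg (by omega)]
      rw [h0'] at this
      simpa using this
  obtain ⟨A, hAX, hA, hB⟩ := exists_partition (H := fun u v => ex u v = 1)
    (L := fun u v => ex u v ≤ -1) hb1 (by linarith) hx hXn
    (fun u v h => by rw [esymm]; exact h) (fun u v h => by omega) tri c4 hdeg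
  refine pairSum_le_optVal_of_partition vdiag hAX
    (fun u hu v hv => (hve u v).trans (by exact_mod_cast hle1 u hu v hv))
    (fun u hu v hv huv => hneg u v (hA u hu v hv huv)) fun u hu v hv => ?_
  have h1 := hle1 u (sdiff_subset hu) v (sdiff_subset hv)
  have h2 := hB u hu v hv
  exact (hve u v).trans (by exact_mod_cast (by omega : ex u v ≤ 0))

lemma pairSum_le_optVal_add (hb1 : 1 ≤ b) (hb2 : b ≤ 7 / 4)
    (esymm : ∀ u v, ex u v = ex v u) (ediag : ∀ u, ex u u = 0)
    (vsymm : ∀ u v, val u v = val v u) (vdiag : ∀ u, val u u = 0)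
    (hve : ∀ u v, val u v ≤ ex u v) (hneg : ∀ u v, ex u v ≤ -1 → val u v ≤ -b)
    (h7 : ∀ Z, #Z = 7 → pairSum ex Z ≤ 18) (X : Finset V) (hX : 7 ≤ #X) :
    pairSum val X ≤ optVal b #X ∨ pairSum val X ≤ optVal b #X + (2 * 10 ^ 12 - #X) := by
  induction X using Finset.strongInduction with
  | H X ih =>
    rcases lt_or_ge #X 1000000 with hlt | hge
    · right
      have h1 := pairSum_le_of_card_seven esymm ediag #X hX X (fun Z _ => h7 Z) rfl
      have h2 : pairSum val X ≤ ((pairSum ex X : ℤ) : ℝ) := by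
        calc pairSum val X ≤ ∑ u ∈ X, ∑ v ∈ X, (ex u v : ℝ) :=
            sum_le_sum fun u _ => sum_le_sum fun v _ => hve u v
          _ = ((pairSum ex X : ℤ) : ℝ) := by simp [pairSum]
      have h3 : (7 : ℝ) * ((pairSum ex X : ℤ) : ℝ) ≤ 3 * (#X * (#X - 1)) := by exact_mod_cast h1
      have h4 : (#X : ℝ) ≤ 1000000 := by exact_mod_cast hlt.le
      have h5 := optVal_nonneg b #X
      have h6 : (0 : ℝ) ≤ #X := by positivity
      nlinarith
    · rcases pairSum_le_or_improvable hb1 hb2 esymm ediag vsymm vdiag hve hneg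
        (fun Z _ => h7 Z) hge with h | ⟨Y, hYX, hY7, hlt, hle, hY⟩
      · exact Or.inl h
      · have hle' : (#X : ℝ) ≤ #Y + 6 := by exact_mod_cast hle
        rcases ih Y (hYX.ssubset_of_ne (by rintro rfl; exact lt_irrefl _ hlt)) hY7 with h | h
        · left; linarith
        · right; linarith

end Descent

section Logarithms

variable {a : ℕ}

/-- The logarithmic gain of multiplicity `a + 1` over multiplicity `a`. -/
noncomputable def logGain (a : ℕ) : ℝ := Real.log (a + 1) - Real.log a

/-- The logarithmic loss of multiplicity `a - 1` compared with multiplicity `a`, in units of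
`logGain a`. -/
noncomputable def lossRatio (a : ℕ) : ℝ := (Real.log a - Real.log (a - 1)) / logGain a

lemma logGain_pos (ha : 2 ≤ a) : 0 < logGain a :=
  sub_pos.2 (Real.log_lt_log (by positivity) (by linarith))

lemma one_le_lossRatio (ha : 2 ≤ a) : 1 ≤ lossRatio a := by
  have ha' : (2 : ℝ) ≤ a := by exact_mod_cast ha
  rw [lossRatio, one_le_div (logGain_pos ha), logGain]
  have h : Real.log ((a - 1) * (a + 1)) ≤ Real.log (a * a) :=
    Real.log_le_log (by nlinarith) (by nlinarith)
  rw [Real.log_mul (by linarith) (by linarith), Real.log_mul (by linarith) (by linarith)] at h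
  linarith

lemma lossRatio_le (ha : 2 ≤ a) : lossRatio a ≤ 7 / 4 := by
  have ha' : (2 : ℝ) ≤ a := by exact_mod_cast ha
  rw [lossRatio, div_le_iff₀ (logGain_pos ha), logGain]
  have hpoly : (a : ℝ) ^ 11 ≤ (a - 1) ^ 4 * (a + 1) ^ 7 := by
    obtain ⟨t, ht⟩ : ∃ t : ℝ, (a : ℝ) = 2 + t := ⟨a - 2, by ring⟩
    have ht0 : 0 ≤ t := by linarith
    rw [ht, ← sub_nonneg]
    ring_nf
    positivity
  have h := Real.log_le_log (by positivity) hpoly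
  have h1 : (a - 1 : ℝ) ≠ 0 := by linarith
  have h2 : (a + 1 : ℝ) ≠ 0 := by linarith
  rw [Real.log_mul (pow_ne_zero _ h1) (pow_ne_zero _ h2), Real.log_pow, Real.log_pow,
    Real.log_pow] at h
  push_cast at h
  linarith

lemma log_sub_log_le (ha : 2 ≤ a) {m : ℕ} (hm : 0 < m) :
    Real.log m - Real.log a ≤ ((m : ℝ) - a) * logGain a := by
  have ha' : (2 : ℝ) ≤ a := by exact_mod_cast ha
  have hm' : (0 : ℝ) < m := by exact_mod_cast hm
  have hgain : logGain a = Real.log (1 + 1 / a) := by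
    rw [logGain, ← Real.log_div (by linarith) (by linarith)]
    congr 1
    field_simp
  rw [← Real.log_div hm'.ne' (by linarith)]
  rcases le_total a m with h | h
  · obtain ⟨k, rfl⟩ := Nat.exists_eq_add_of_le h
    have hb := one_add_mul_le_pow (a := 1 / (a : ℝ))
      (by linarith [show 0 ≤ 1 / (a : ℝ) by positivity]) k
    have hl := Real.log_le_log (by positivity) hb
    rw [Real.log_pow, ← hgain] at hl
    convert hl using 2
    · push_cast
      field_simp
    · push_cast
      ring
  · have h1 : logGain a ≤ 1 / a := by
      rw [hgain]
      have := Real.log_le_sub_one_of_pos (x := 1 + 1 / (a : ℝ)) (by positivity)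
      linarith
    have h2 := Real.log_le_sub_one_of_pos (x := (m : ℝ) / a) (by positivity)
    have h3 : (m : ℝ) / a - 1 = (m - a) * (1 / a) := by field_simp
    have h4 : (m : ℝ) ≤ a := by exact_mod_cast h
    nlinarith

end Logarithms

section Multigraphs

variable {n a : ℕ} {w : Finset (Fin n) → ℕ}

/-- The excess of the multiplicity of `uv` over `a`. -/
def excess (a : ℕ) (w : Finset (Fin n) → ℕ) (u v : Fin n) : ℤ :=
  if u = v then 0 else w {u, v} - a

/-- The logarithm of the multiplicity of `uv`, normalised so that multiplicity `a` has value `0`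
and multiplicity `a + 1` has value `1`. -/
noncomputable def logValue (a : ℕ) (w : Finset (Fin n) → ℕ) (u v : Fin n) : ℝ :=
  if u = v then 0 else (Real.log (w {u, v}) - Real.log a) / logGain a

lemma pairSum_excess (a : ℕ) (w : Finset (Fin n) → ℕ) (X : Finset (Fin n)) :
    pairSum (excess a w) X = 2 * (edgeSum n w X - (#X).choose 2 * a) := by
  have h := two_nsmul_sum_powersetCard_two (fun p => (w p : ℤ) - a) X
  rw [sum_sub_distrib, sum_const, card_powersetCard, nsmul_eq_mul, nsmul_eq_mul] at h
  rw [edgeSum]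
  push_cast at h ⊢
  exact h.symm

lemma pairSum_logValue (a : ℕ) {X : Finset (Fin n)} (hw : edgeProd n w X ≠ 0) :
    pairSum (logValue a w) X
      = 2 * ((Real.log (edgeProd n w X) - (#X).choose 2 * Real.log a) / logGain a) := by
  have h := two_nsmul_sum_powersetCard_two
    (fun p => (Real.log (w p) - Real.log a) / logGain a) X
  rw [← sum_div, sum_sub_distrib, sum_const, card_powersetCard, nsmul_eq_mul, nsmul_eq_mul] at h
  rw [edgeProd, Nat.cast_prod, Real.log_prod]
  · exact h.symm
  · intro p hp
    exact_mod_cast prod_ne_zero_iff.1 hw p hp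

lemma pairSum_logValue_le (ha : 2 ≤ a) (hn : 2 * 10 ^ 12 ≤ n) (hF : IsF n 7 (21 * a + 9) w)
    (hw : edgeProd n w univ ≠ 0) :
    pairSum (logValue a w) univ ≤ optVal (lossRatio a) n := by
  have hpos : ∀ u v, u ≠ v → 0 < w {u, v} := fun u v huv =>
    Nat.pos_of_ne_zero (prod_ne_zero_iff.1 hw _ (mem_powersetCard.2 ⟨subset_univ _, card_pair huv⟩))
  have hgain := logGain_pos ha
  have hve : ∀ u v, logValue a w u v ≤ excess a w u v := by
    intro u v
    rw [logValue, excess]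
    split_ifs with huv
    · simp
    · rw [div_le_iff₀ hgain]
      push_cast
      exact log_sub_log_le ha (hpos u v huv)
  have hneg : ∀ u v, excess a w u v ≤ -1 → logValue a w u v ≤ -lossRatio a := by
    intro u v h
    rcases eq_or_ne u v with rfl | huv
    · simp [excess] at h
    · rw [excess, if_neg huv] at h
      rw [logValue, if_neg huv, lossRatio, ← neg_div]
      have h1 : (w {u, v} : ℝ) ≤ a - 1 := by
        have h2 : (w {u, v} : ℤ) ≤ a - 1 := by linarith
        exact_mod_cast h2
      have h2 := Real.log_le_log (by exact_mod_cast hpos u v huv) h1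
      exact div_le_div_of_nonneg_right (by linarith) hgain.le
  have h := pairSum_le_optVal_add (one_le_lossRatio ha) (lossRatio_le ha)
    (fun u v => by simp only [excess, eq_comm (a := u), pair_comm u]) (fun u => by simp [excess])
    (fun u v => by simp only [logValue, eq_comm (a := u), pair_comm u])
    (fun u => by simp [logValue]) hve hneg
    (fun Z hZ => by
      have h1 := hF Z hZ
      have h2 : (7 : ℕ).choose 2 = 21 := rfl
      rw [pairSum_excess, hZ, h2]
      omega) univ (by rw [card_univ, Fintype.card_fin]; omega)
  rw [card_univ, Fintype.card_fin] at h
  have hn' : (2 * 10 ^ 12 : ℝ) ≤ n := by exact_mod_cast hn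
  rcases h with h | h <;> linarith

/-- The member of `T_{2,1}(a, n)` with `V_0 = A`. -/
def splitGraph (a : ℕ) (A : Finset (Fin n)) (p : Finset (Fin n)) : ℕ :=
  if p ⊆ A then a - 1 else if Disjoint p A then a else a + 1

lemma splitGraph_pair (a : ℕ) (A : Finset (Fin n)) (u v : Fin n) :
    splitGraph a A {u, v} = if u ∈ A then (if v ∈ A then a - 1 else a + 1)
      else if v ∈ A then a + 1 else a := by
  by_cases hu : u ∈ A <;> by_cases hv : v ∈ A <;>
    simp [splitGraph, insert_subset_iff, hu, hv]

lemma inT_splitGraph (a : ℕ) (A : Finset (Fin n)) : InT n 2 1 a (splitGraph a A) := by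
  refine ⟨fun v => if v ∈ A then 0 else 1, fun v => by dsimp only; split_ifs <;> norm_num, ?_⟩
  intro u v _
  rw [splitGraph_pair]
  by_cases hu : u ∈ A <;> by_cases hv : v ∈ A <;> simp [hu, hv]

lemma excess_of_inT (ha : 1 ≤ a) (hw : InT n 2 1 a w) :
    ∃ A : Finset (Fin n), excess a w = splitWeight (-1) A := by
  obtain ⟨f, hf, h⟩ := hw
  refine ⟨univ.filter fun v => f v = 0, ?_⟩
  ext u v
  rw [excess, splitWeight]
  split_ifs with huv hu hv hv <;> simp only [mem_filter, mem_univ, true_and] at * <;>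
    have hfu := hf u <;> have hfv := hf v
  · rw [h u v huv, if_pos (by omega), if_pos (by omega)]; omega
  · rw [h u v huv, if_neg (by omega)]; omega
  · rw [h u v huv, if_neg (by omega)]; omega
  · rw [h u v huv, if_pos (by omega), if_neg (by omega)]; omega

lemma isF_of_inT (ha : 1 ≤ a) (hw : InT n 2 1 a w) : IsF n 7 (21 * a + 9) w := by
  intro X hX
  obtain ⟨A, hA⟩ := excess_of_inT ha hw
  have h := pairSum_excess a w X
  have h2 : (7 : ℕ).choose 2 = 21 := rfl
  rw [hA, pairSum_splitWeight, hX, h2] at h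
  have hc := card_inter_add_card_sdiff X A
  rw [hX] at hc
  have h3 : (#(X \ A) : ℤ) = 7 - #(X ∩ A) := by omega
  rw [h3] at h
  have h4 : #(X ∩ A) ≤ 7 := by omega
  interval_cases #(X ∩ A) <;> norm_num at h <;> omega

lemma edgeProd_splitGraph_pos (ha : 2 ≤ a) (A X : Finset (Fin n)) :
    0 < edgeProd n (splitGraph a A) X := by
  refine prod_pos fun p _ => ?_
  rw [splitGraph]
  split_ifs <;> omega

lemma pairSum_logValue_splitGraph (ha : 2 ≤ a) (A : Finset (Fin n)) :
    pairSum (logValue a (splitGraph a A)) univ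
      = 2 * (#A : ℝ) * (n - #A) - lossRatio a * (#A * (#A - 1)) := by
  have hgain := (logGain_pos ha).ne'
  have h : logValue a (splitGraph a A) = splitWeight (-lossRatio a) A := by
    ext u v
    rw [logValue, splitWeight, splitGraph_pair]
    split_ifs with huv hu hv hv
    · rfl
    · rw [lossRatio, Nat.cast_sub (by omega), Nat.cast_one]; ring
    · rw [Nat.cast_succ, ← logGain, div_self hgain]
    · rw [Nat.cast_succ, ← logGain, div_self hgain]
    · simp
  rw [h, pairSum_splitWeight, univ_inter, cast_card_sdiff (subset_univ A), card_univ,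
    Fintype.card_fin]
  ring

/-- Some member of `T_{2,1}(a, n)` has the largest edge product among all
`(n, 7, 21a + 9)`-graphs. -/
lemma exists_inT_forall_edgeProd_le (ha : 2 ≤ a) (hn : 2 * 10 ^ 12 ≤ n) :
    ∃ w₀, InT n 2 1 a w₀ ∧
      ∀ w, IsF n 7 (21 * a + 9) w → edgeProd n w univ ≤ edgeProd n w₀ univ := by
  obtain ⟨k, hkn, hk⟩ := exists_eq_optVal (lossRatio a) n
  obtain ⟨A, -, hA⟩ := exists_subset_card_eq
    (show k ≤ #(univ : Finset (Fin n)) by rwa [card_univ, Fintype.card_fin])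
  refine ⟨splitGraph a A, inT_splitGraph a A, fun w hw => ?_⟩
  rcases Nat.eq_zero_or_pos (edgeProd n w univ) with h0 | h0
  · rw [h0]; exact Nat.zero_le _
  have hpos := edgeProd_splitGraph_pos ha A univ
  have h1 := pairSum_logValue_le ha hn hw h0.ne'
  rw [hk, ← hA, ← pairSum_logValue_splitGraph ha A, pairSum_logValue a h0.ne',
    pairSum_logValue a hpos.ne'] at h1
  have h2 := (div_le_div_iff_of_pos_right (logGain_pos ha)).1 (le_of_mul_le_mul_left h1 two_pos)
  have h3 := (Real.log_le_log_iff (by exact_mod_cast h0) (by exact_mod_cast hpos)).1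
    (sub_le_sub_iff_right _ |>.1 h2)
  exact_mod_cast h3

end Multigraphs

/-- There exists `N₀` such that for all integers `a ≥ 2` and `n ≥ N₀`,
`ex_Π(n, 7, 21a + 9) = Π_{2,1}(a, n)`. -/
theorem exPi_seven : ∃ N₀ : ℕ, ∀ a n : ℕ, 2 ≤ a → N₀ ≤ n →
    exPi n 7 (21 * a + 9) = PiT 2 1 a n := by
  refine ⟨2 * 10 ^ 12, fun a n ha hn => ?_⟩
  obtain ⟨w₀, hT, hmax⟩ := exists_inT_forall_edgeProd_le ha hn
  have ha1 : 1 ≤ a := by omega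
  have h1 : IsGreatest {P | ∃ w : Finset (Fin n) → ℕ, IsF n 7 (21 * a + 9) w ∧
      P = edgeProd n w Finset.univ} (edgeProd n w₀ univ) :=
    ⟨⟨w₀, isF_of_inT ha1 hT, rfl⟩, by rintro _ ⟨w, hw, rfl⟩; exact hmax w hw⟩
  have h2 : IsGreatest {P | ∃ w : Finset (Fin n) → ℕ, InT n 2 1 a w ∧
      P = edgeProd n w Finset.univ} (edgeProd n w₀ univ) :=
    ⟨⟨w₀, hT, rfl⟩, by rintro _ ⟨w, hw, rfl⟩; exact hmax w (isF_of_inT ha1 hw)⟩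
  rw [exPi, PiT, h1.csSup_eq, h2.csSup_eq]
end

section
/- Step-up theorem: let r, d ∈ ℕ with r ≥ 2 and let s ≥ (r−1)(d+1) + 2. Suppose there exist a₀, n₀ ∈ ℕ such that for all integers a ≥ a₀ (with a > d) and all n ≥ n₀ one has ex_Π(n, s, Σ_{r,d}(a,s)) = Π_{r,d}(a,n). Then there exist a₁ ≥ a₀ and n₁ ≥ n₀ such that for all integers a ≥ a₁ and all n ≥ n₁ one has ex_Π(n, s+1, Σ_{r,d}(a,s+1)) = Π_{r,d}(a,n). -/
open Finset

@[to_additive]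
lemma prod_powersetCard_two_insert {α M : Type*} [DecidableEq α] [CommMonoid M]
    (w : Finset α → M) {X : Finset α} {v : α} (hv : v ∉ X) :
    ∏ p ∈ (insert v X).powersetCard 2, w p =
      (∏ p ∈ X.powersetCard 2, w p) * ∏ u ∈ X, w {u, v} := by
  rw [powersetCard_succ_insert hv, prod_union, prod_image, powersetCard_one, prod_map]
  · congr 1
    refine prod_congr rfl fun u _ => ?_
    simp [pair_comm]
  · intro p hp q hq h
    have h1 := erase_insert (fun h => hv ((mem_powersetCard.1 (mem_coe.1 hp)).1 h))
    have h2 := erase_insert (fun h => hv ((mem_powersetCard.1 (mem_coe.1 hq)).1 h))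
    rw [← h1, ← h2, h]
  · rw [disjoint_left]
    intro p hp hq
    obtain ⟨q, _, rfl⟩ := mem_image.1 hq
    exact hv ((mem_powersetCard.1 hp).1 (mem_insert_self _ _))

lemma edgeSum_insert {n : ℕ} (w : Finset (Fin n) → ℕ) {X : Finset (Fin n)} {v : Fin n}
    (hv : v ∉ X) : edgeSum n w (insert v X) = edgeSum n w X + ∑ u ∈ X, w {u, v} :=
  sum_powersetCard_two_insert w hv

lemma edgeProd_insert {n : ℕ} (w : Finset (Fin n) → ℕ) {X : Finset (Fin n)} {v : Fin n}
    (hv : v ∉ X) : edgeProd n w (insert v X) = edgeProd n w X * ∏ u ∈ X, w {u, v} :=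
  prod_powersetCard_two_insert w hv

lemma edgeSum_map {m n : ℕ} (w : Finset (Fin n) → ℕ) (e : Fin m ↪ Fin n) (X : Finset (Fin m)) :
    edgeSum m (fun p => w (p.map e)) X = edgeSum n w (X.map e) := by
  unfold edgeSum
  rw [powersetCard_map, sum_map]
  rfl

lemma edgeProd_map {m n : ℕ} (w : Finset (Fin n) → ℕ) (e : Fin m ↪ Fin n) (X : Finset (Fin m)) :
    edgeProd m (fun p => w (p.map e)) X = edgeProd n w (X.map e) := by
  unfold edgeProd
  rw [powersetCard_map, prod_map]
  rfl

lemma IsF.comap {m n s q : ℕ} {w : Finset (Fin n) → ℕ} (h : IsF n s q w) (e : Fin m ↪ Fin n) :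
    IsF m s q (fun p => w (p.map e)) := by
  intro X hX
  rw [edgeSum_map]
  exact h _ (by rw [card_map, hX])

lemma InT.comap {m n r d a : ℕ} {w : Finset (Fin n) → ℕ} (h : InT n r d a w)
    (e : Fin m ↪ Fin n) : InT m r d a (fun p => w (p.map e)) := by
  obtain ⟨f, hf, hw⟩ := h
  refine ⟨f ∘ e, fun v => hf _, fun u v huv => ?_⟩
  simp only [Finset.map_insert, map_singleton, Function.comp]
  exact hw _ _ (e.injective.ne huv)

/-- Every vertex set is the image of an initial segment of the right size. -/
lemma exists_map_univ_eq {m n : ℕ} {X : Finset (Fin n)} (hX : X.card = m) :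
    ∃ e : Fin m ↪ Fin n, univ.map e = X := by
  refine ⟨(X.orderEmbOfFin hX).toEmbedding, ?_⟩
  simp

lemma exists_inT_of_labelling {n r : ℕ} (d a : ℕ) (f : Fin n → ℕ) (hf : ∀ v, f v < r) :
    ∃ w : Finset (Fin n) → ℕ, InT n r d a w ∧ ∀ u v : Fin n,
      w {u, v} = if f u = f v then (if f u = 0 then a - d else a) else a + 1 := by
  have key : ∃ w : Finset (Fin n) → ℕ, ∀ u v : Fin n,
      w {u, v} = if f u = f v then (if f u = 0 then a - d else a) else a + 1 := by
    refine ⟨fun p => if ∀ u ∈ p, ∀ v ∈ p, f u = f v then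
      (if ∀ u ∈ p, f u = 0 then a - d else a) else a + 1, fun u v => ?_⟩
    by_cases h : f u = f v
    · simp [h]
    · simp [h]
  obtain ⟨w, hw⟩ := key
  exact ⟨w, ⟨f, hf, fun u v _ => hw u v⟩, hw⟩

lemma InT.le {n r d a : ℕ} {w : Finset (Fin n) → ℕ} (h : InT n r d a w) {p : Finset (Fin n)}
    {X : Finset (Fin n)} (hp : p ∈ X.powersetCard 2) : w p ≤ a + 1 := by
  obtain ⟨f, _, hw⟩ := h
  obtain ⟨u, v, huv, rfl⟩ := card_eq_two.1 (mem_powersetCard.1 hp).2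
  rw [hw u v huv]
  split_ifs <;> omega

lemma InT.edgeSum_le {n r d a : ℕ} {w : Finset (Fin n) → ℕ} (h : InT n r d a w) :
    edgeSum n w univ ≤ (a + 1) * n.choose 2 := by
  refine (sum_le_card_nsmul _ _ (a + 1) fun p hp => h.le hp).trans ?_
  simp [mul_comm]

lemma InT.edgeProd_le {n r d a : ℕ} {w : Finset (Fin n) → ℕ} (h : InT n r d a w) :
    edgeProd n w univ ≤ (a + 1) ^ n.choose 2 := by
  refine (prod_le_pow_card _ _ (a + 1) fun p hp => h.le hp).trans ?_
  simp

lemma exists_inT {r : ℕ} (hr : 2 ≤ r) (n d a : ℕ) : ∃ w, InT n r d a w := by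
  obtain ⟨w, hw, _⟩ := exists_inT_of_labelling (r := r) d a (fun _ : Fin n => 0)
    (fun _ => by omega)
  exact ⟨w, hw⟩

lemma InT.edgeSum_le_SigmaT {n r d a : ℕ} {w : Finset (Fin n) → ℕ} (h : InT n r d a w) :
    edgeSum n w univ ≤ SigmaT r d a n :=
  le_csSup ⟨(a + 1) * n.choose 2, by rintro _ ⟨w, hw, rfl⟩; exact hw.edgeSum_le⟩ ⟨w, h, rfl⟩

lemma InT.edgeProd_le_PiT {n r d a : ℕ} {w : Finset (Fin n) → ℕ} (h : InT n r d a w) :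
    edgeProd n w univ ≤ PiT r d a n :=
  le_csSup ⟨(a + 1) ^ n.choose 2, by rintro _ ⟨w, hw, rfl⟩; exact hw.edgeProd_le⟩ ⟨w, h, rfl⟩

lemma exists_edgeSum_eq_SigmaT {r : ℕ} (hr : 2 ≤ r) (d a n : ℕ) :
    ∃ w, InT n r d a w ∧ SigmaT r d a n = edgeSum n w univ := by
  obtain ⟨w, hw⟩ := exists_inT hr n d a
  exact Nat.sSup_mem (s := {e | ∃ w : Finset (Fin n) → ℕ, InT n r d a w ∧ e = edgeSum n w univ})
    ⟨_, w, hw, rfl⟩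
    ⟨(a + 1) * n.choose 2, by rintro _ ⟨w, hw, rfl⟩; exact hw.edgeSum_le⟩

lemma exists_edgeProd_eq_PiT {r : ℕ} (hr : 2 ≤ r) (d a n : ℕ) :
    ∃ w, InT n r d a w ∧ PiT r d a n = edgeProd n w univ := by
  obtain ⟨w, hw⟩ := exists_inT hr n d a
  exact Nat.sSup_mem (s := {e | ∃ w : Finset (Fin n) → ℕ, InT n r d a w ∧ e = edgeProd n w univ})
    ⟨_, w, hw, rfl⟩
    ⟨(a + 1) ^ n.choose 2, by rintro _ ⟨w, hw, rfl⟩; exact hw.edgeProd_le⟩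

lemma SigmaT_le {r : ℕ} (hr : 2 ≤ r) (d a n : ℕ) : SigmaT r d a n ≤ (a + 1) * n.choose 2 := by
  obtain ⟨w, hw, h⟩ := exists_edgeSum_eq_SigmaT hr d a n
  exact h ▸ hw.edgeSum_le

lemma InT.isF {n r d a s : ℕ} {w : Finset (Fin n) → ℕ} (h : InT n r d a w) :
    IsF n s (SigmaT r d a s) w := by
  intro X hX
  obtain ⟨e, rfl⟩ := exists_map_univ_eq hX
  rw [← edgeSum_map]
  exact (h.comap e).edgeSum_le_SigmaT

lemma sum_erase_edgeSum {n k : ℕ} (w : Finset (Fin n) → ℕ) {Y : Finset (Fin n)}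
    (hY : Y.card = k + 2) : ∑ v ∈ Y, edgeSum n w (Y.erase v) = k * edgeSum n w Y := by
  have h1 : ∀ v ∈ Y, edgeSum n w (Y.erase v) =
      ∑ p ∈ Y.powersetCard 2, if v ∈ p then 0 else w p := by
    intro v _
    unfold edgeSum
    rw [sum_ite, sum_const_zero, zero_add]
    refine sum_congr ?_ fun _ _ => rfl
    ext p
    simp only [mem_powersetCard, mem_filter, subset_erase]
    tauto
  rw [sum_congr rfl h1, sum_comm, edgeSum, mul_sum]
  refine sum_congr rfl fun p hp => ?_
  obtain ⟨hpY, hp2⟩ := mem_powersetCard.1 hp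
  rw [sum_ite, sum_const_zero, zero_add, sum_const, smul_eq_mul, ← sdiff_eq_filter,
    card_sdiff_of_subset hpY]
  congr 1
  omega

lemma IsF.edgeSum_le {n m b : ℕ} {w : Finset (Fin n) → ℕ} (hm : 2 ≤ m)
    (h : IsF n m (b * m.choose 2) w) (k : ℕ) (hk : m ≤ k) :
    ∀ Y : Finset (Fin n), Y.card = k → edgeSum n w Y ≤ b * k.choose 2 := by
  induction k, hk using Nat.le_induction with
  | base => exact h
  | succ k hk ih =>
    intro Y hY
    obtain ⟨j, rfl⟩ : ∃ j, k = j + 2 := ⟨k - 2, by omega⟩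
    have h1 := sum_erase_edgeSum (k := j + 1) w (Y := Y) (by omega)
    have h2 := sum_le_card_nsmul Y (fun v => edgeSum n w (Y.erase v)) (b * (j + 2).choose 2)
      fun v hv => ih _ (by rw [card_erase_of_mem hv, hY]; omega)
    have h3 : (j + 3) * (j + 2).choose 2 = (j + 1) * (j + 3).choose 2 := by
      have := Nat.choose_mul_succ_eq (j + 2) 2
      simp only [show j + 2 + 1 - 2 = j + 1 by omega] at this
      linarith
    rw [h1, hY, smul_eq_mul] at h2
    refine Nat.le_of_mul_le_mul_left (c := j + 1) ?_ (by omega)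
    calc _ ≤ _ := h2
      _ = b * ((j + 3) * (j + 2).choose 2) := by ring
      _ = _ := by rw [h3]; ring

lemma sum_card_fiber {n r : ℕ} (f : Fin n → ℕ) (hf : ∀ v, f v < r + 1) :
    n = (∑ i ∈ range r, (univ.filter fun v => f v = i + 1).card) +
      (univ.filter fun v => f v = 0).card := by
  have := card_eq_sum_card_fiberwise (s := (univ : Finset (Fin n))) (t := range (r + 1)) (f := f)
    (fun v _ => by simpa using hf v)
  rw [sum_range_succ'] at this
  simpa using this

lemma exists_SigmaT_succ_add_le {r : ℕ} (hr : 2 ≤ r) (d a s : ℕ) (hda : d < a) :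
    ∃ L, SigmaT r d a (s + 1) + L ≤ SigmaT r d a s + (a + 1) * s ∧
      (d + 1) * s + 1 ≤ ((r - 1) * (d + 1) + 1) * (L + 1) := by
  obtain ⟨w, hT, hw⟩ := exists_edgeSum_eq_SigmaT hr d a (s + 1)
  obtain ⟨r, rfl⟩ : ∃ t, r = t + 1 := ⟨r - 1, by omega⟩
  obtain ⟨f, hf, hfw⟩ := id hT
  set loss : Fin (s + 1) → ℕ := fun v =>
    (if f v = 0 then d + 1 else 1) * ((univ.erase v).filter fun u => f u = f v).card with hloss
  have hfib (v : Fin (s + 1)) : (univ.filter fun u => f u = f v).card =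
      ((univ.erase v).filter fun u => f u = f v).card + 1 := by
    rw [filter_erase, card_erase_add_one (by simp)]
  obtain ⟨v, -, hv⟩ := exists_max_image univ loss ⟨0, mem_univ _⟩
  refine ⟨loss v, ?_, ?_⟩
  · have hdeg : ∑ u ∈ univ.erase v, w {u, v} + loss v = (a + 1) * s := by
      have h1 : ∀ u ∈ univ.erase v, w {u, v} +
          (if f u = f v then (if f v = 0 then d + 1 else 1) else 0) = a + 1 := by
        intro u hu
        rw [hfw u v (ne_of_mem_erase hu)]
        split_ifs <;> omega
      have h2 := sum_congr rfl h1
      rw [sum_add_distrib, ← sum_filter, sum_const, sum_const, card_erase_of_mem (mem_univ _),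
        card_univ, Fintype.card_fin, smul_eq_mul, smul_eq_mul] at h2
      rw [hloss]
      simp only [Nat.add_sub_cancel] at h2
      linarith
    have h3 := edgeSum_insert w (notMem_erase v univ)
    rw [insert_erase (mem_univ v)] at h3
    have h4 := hT.isF (s := s) (univ.erase v) (by simp)
    omega
  · have h1 : ∀ i ∈ range r, (univ.filter fun u => f u = i + 1).card ≤ loss v + 1 := by
      intro i _
      obtain h | ⟨u, hu⟩ := (univ.filter fun u => f u = i + 1).eq_empty_or_nonempty
      · simp [h]
      · have hu : f u = i + 1 := by simpa using hu
        have := hv u (mem_univ _)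
        rw [hloss] at this ⊢
        rw [← hu, hfib]
        simp only [hu, Nat.succ_ne_zero, if_false] at this ⊢
        omega
    have h2 : (d + 1) * (univ.filter fun u => f u = 0).card ≤ loss v + (d + 1) := by
      obtain h | ⟨u, hu⟩ := (univ.filter fun u => f u = 0).eq_empty_or_nonempty
      · simp [h]
      · have hu : f u = 0 := by simpa using hu
        have := hv u (mem_univ _)
        have h3 := hfib u
        rw [hu] at h3
        rw [h3, mul_add]
        simp only [hloss, hu, if_true] at this ⊢
        omega
    have h3 := sum_card_fiber f hf
    have h4 := sum_le_card_nsmul _ _ _ h1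
    rw [card_range, smul_eq_mul] at h4
    simp only [Nat.add_sub_cancel]
    nlinarith

lemma exists_part_le {n r : ℕ} (hr : 2 ≤ r) (d : ℕ) (f : Fin n → ℕ) (hf : ∀ v, f v < r) :
    ∃ i < r, ((r - 1) * (d + 1) + 1) *
      ((if i = 0 then d + 1 else 1) * (univ.filter fun v => f v = i).card) ≤ n * (d + 1) := by
  obtain ⟨r, rfl⟩ : ∃ t, r = t + 1 := ⟨r - 1, by omega⟩
  by_contra! H
  simp only [Nat.add_sub_cancel] at H
  have h0 := H 0 (by omega)
  have h1 : ∀ i ∈ range r, n * (d + 1) ≤ (r * (d + 1) + 1) *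
      (univ.filter fun v => f v = i + 1).card := by
    intro i hi
    have := H (i + 1) (by simpa using hi)
    simp only [Nat.succ_ne_zero, if_false, one_mul] at this
    exact this.le
  have h2 := card_nsmul_le_sum _ _ _ h1
  rw [← mul_sum, card_range, smul_eq_mul] at h2
  have h3 := sum_card_fiber f hf
  simp only [if_true] at h0
  have h4 := Nat.mul_le_mul_left (d + 1) h2
  have h5 := congrArg ((r * (d + 1) + 1) * (d + 1) * ·) h3
  linarith

open Real in
lemma prod_le_pow_mul_exp {ι : Type*} (S : Finset ι) (w : ι → ℕ) {b : ℝ} (hb : 0 < b) :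
    ∏ p ∈ S, (w p : ℝ) ≤ b ^ S.card * exp ((∑ p ∈ S, (w p : ℝ)) / b - S.card) := by
  have h1 : ∀ p ∈ S, (w p : ℝ) ≤ b * exp (w p / b - 1) := fun p _ => by
    have := add_one_le_exp ((w p : ℝ) / b - 1)
    rw [sub_add_cancel, div_le_iff₀ hb] at this
    linarith
  refine (prod_le_prod (fun _ _ => by positivity) h1).trans_eq ?_
  rw [prod_mul_distrib, prod_const, ← exp_sum, sum_sub_distrib, ← sum_div]
  simp

/-- The rate of decay of `PiT r d a n` compared with `(a + 1) ^ n.choose 2`. -/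
noncomputable def decayRate (r d a : ℕ) : ℝ :=
  (d + 1) / (((r - 1 : ℕ) * (d + 1) + 1) * (a - d))

open Real in
lemma PiT_mul_le_PiT_succ {r d a : ℕ} (hr : 2 ≤ r) (hda : d < a) (n : ℕ) :
    (PiT r d a n : ℝ) * ((a + 1 : ℝ) ^ n * exp (-(decayRate r d a * n))) ≤ PiT r d a (n + 1) := by
  obtain ⟨w, hT, hw⟩ := exists_edgeProd_eq_PiT hr d a n
  obtain ⟨f, hf, hfw⟩ := hT
  obtain ⟨i, hir, hi⟩ := exists_part_le hr d f hf
  obtain ⟨w', hT', hw'⟩ := exists_inT_of_labelling (r := r) d a (Fin.snoc f i : Fin (n + 1) → ℕ)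
    (fun v => by induction v using Fin.lastCases <;> simp [hir, hf])
  have hsplit : edgeProd (n + 1) w' univ = edgeProd n w univ *
      ∏ u : Fin n, w' {u.castSucc, Fin.last n} := by
    have h1 : (univ : Finset (Fin (n + 1))) = insert (Fin.last n) (univ.map Fin.castSuccEmb) := by
      rw [Fin.univ_castSuccEmb, cons_eq_insert]
    rw [h1, edgeProd_insert _ (by simp), ← edgeProd_map, prod_map]
    congr 1
    refine prod_congr rfl fun p hp => ?_
    obtain ⟨u, v, huv, rfl⟩ := card_eq_two.1 (mem_powersetCard.1 hp).2
    rw [hfw u v huv]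
    simp [hw']
  have had : (0 : ℝ) < a - d := sub_pos.2 (by exact_mod_cast hda)
  set loss : ℝ := (if i = 0 then d + 1 else 1 : ℝ)
  have hdeg : ∀ u : Fin n, (a + 1 : ℝ) * exp (-((if f u = i then loss else 0) / (a - d))) ≤
      (w' {u.castSucc, Fin.last n} : ℝ) := by
    intro u
    rw [hw']
    simp only [Fin.snoc_castSucc, Fin.snoc_last]
    by_cases hu : f u = i
    · simp only [hu, if_true, loss]
      rw [exp_neg, ← div_eq_mul_inv, div_le_iff₀ (exp_pos _)]
      split_ifs
      · rw [Nat.cast_sub hda.le]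
        have := add_one_le_exp (((d : ℝ) + 1) / (a - d))
        calc (a + 1 : ℝ) = (a - d) * ((d + 1) / (a - d) + 1) := by field_simp; ring
          _ ≤ _ := by gcongr
      · have := add_one_le_exp ((1 : ℝ) / (a - d))
        have ha : (1 : ℝ) ≤ a * (1 / (a - d)) := by
          rw [mul_one_div, le_div_iff₀ had]
          linarith [(Nat.cast_nonneg d : (0 : ℝ) ≤ d)]
        calc (a + 1 : ℝ) ≤ a * (1 / (a - d) + 1) := by linarith
          _ ≤ _ := by gcongr
    · simp [hu]
  have hprod := prod_le_prod (s := univ) (fun _ _ => by positivity) (fun u _ => hdeg u)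
  rw [prod_mul_distrib, prod_const, card_univ, Fintype.card_fin, ← exp_sum, sum_neg_distrib,
    ← sum_div, ← sum_filter, sum_const, nsmul_eq_mul] at hprod
  have hloss : (univ.filter fun u => f u = i).card * loss / (a - d) ≤ decayRate r d a * n := by
    have h1 : (((r - 1 : ℕ) : ℝ) * (d + 1) + 1) *
        (loss * (univ.filter fun u => f u = i).card) ≤ n * (d + 1) := by
      have := (Nat.cast_le (α := ℝ)).2 hi
      push_cast at this
      exact this
    unfold decayRate
    rw [div_mul_eq_mul_div, div_le_div_iff₀ had (by positivity)]
    nlinarith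
  calc (PiT r d a n : ℝ) * ((a + 1 : ℝ) ^ n * exp (-(decayRate r d a * n)))
      ≤ PiT r d a n * ∏ u : Fin n, (w' {u.castSucc, Fin.last n} : ℝ) := by
        refine mul_le_mul_of_nonneg_left (le_trans ?_ hprod) (by positivity)
        gcongr
    _ = (edgeProd (n + 1) w' univ : ℝ) := by rw [hsplit, hw]; push_cast; rfl
    _ ≤ _ := by exact_mod_cast hT'.edgeProd_le_PiT

open Real in
lemma PiT_mul_le_PiT_add {r d a : ℕ} (hr : 2 ≤ r) (hda : d < a) (n k : ℕ) :
    (PiT r d a n : ℝ) * ((a + 1 : ℝ) ^ (k.choose 2 + n * k) *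
      exp (-(decayRate r d a * (k.choose 2 + n * k : ℕ)))) ≤ PiT r d a (n + k) := by
  induction k with
  | zero => simp
  | succ k ih =>
    refine le_trans (le_of_eq ?_) ((mul_le_mul_of_nonneg_right ih ?_).trans
      (PiT_mul_le_PiT_succ hr hda (n + k)))
    · rw [show (k + 1).choose 2 + n * (k + 1) = (k.choose 2 + n * k) + (n + k) by
        rw [Nat.choose_succ_succ' k 1, Nat.choose_one_right]; ring]
      rw [pow_add, Nat.cast_add, mul_add, neg_add, exp_add]
      ring
    · positivity

open Real in
lemma pow_mul_exp_le_PiT {r d a : ℕ} (hr : 2 ≤ r) (hda : d < a) (n : ℕ) :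
    (a + 1 : ℝ) ^ n.choose 2 * exp (-(decayRate r d a * n.choose 2)) ≤ PiT r d a n := by
  have h := PiT_mul_le_PiT_add hr hda 0 n
  have h0 : (1 : ℝ) ≤ PiT r d a 0 := by
    obtain ⟨w, hw⟩ := exists_inT hr 0 d a
    have := hw.edgeProd_le_PiT
    have he : (univ : Finset (Fin 0)).powersetCard 2 = ∅ := powersetCard_eq_empty.2 (by simp)
    rw [edgeProd, he, prod_empty] at this
    exact_mod_cast this
  simp only [zero_mul, add_zero, zero_add] at h
  refine le_trans ?_ h
  exact le_mul_of_one_le_left (by positivity) h0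

lemma PiT_pos {r d a : ℕ} (hr : 2 ≤ r) (hda : d < a) (n : ℕ) : 0 < PiT r d a n := by
  have := lt_of_lt_of_le (by positivity) (pow_mul_exp_le_PiT hr hda n)
  exact_mod_cast this

lemma add_choose_two_eq (m s : ℕ) :
    (m + s).choose 2 = m.choose 2 + (s.choose 2 + m * s) := by
  induction s with
  | zero => simp
  | succ s ih =>
    rw [← add_assoc, Nat.choose_succ_succ' (m + s) 1, Nat.choose_succ_succ' s 1, ih,
      Nat.choose_one_right, Nat.choose_one_right]
    ring

lemma edgeSum_union_le {n q : ℕ} (w : Finset (Fin n) → ℕ) (X : Finset (Fin n))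
    (h : ∀ v ∉ X, edgeSum n w (insert v X) ≤ q) (Y : Finset (Fin n)) (hXY : Disjoint X Y) :
    edgeSum n w (X ∪ Y) + Y.card * edgeSum n w X ≤
      edgeSum n w X + edgeSum n w Y + Y.card * q := by
  induction Y using Finset.induction_on with
  | empty => simp
  | insert v Y hv ih =>
    rw [disjoint_insert_right] at hXY
    have h1 := ih hXY.2
    have h2 := h v hXY.1
    rw [edgeSum_insert _ hXY.1] at h2
    rw [union_insert, edgeSum_insert _ (by simp [hXY.1, hv]), edgeSum_insert _ hv,
      card_insert_of_notMem hv, sum_union hXY.2]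
    linarith

open Real in
lemma edgeProd_le_of_dense_subset {n s q : ℕ} {w : Finset (Fin n) → ℕ} {b : ℝ} (hb : 0 < b)
    (hF : IsF n (s + 1) q w) {X : Finset (Fin n)} (hX : X.card = s) {m : ℕ} (hm : n = m + s) :
    (edgeProd n w univ : ℝ) ≤ edgeProd n w Xᶜ * (b ^ (s.choose 2 + m * s) *
      exp ((edgeSum n w X + m * q - m * edgeSum n w X) / b - (s.choose 2 + m * s : ℕ))) := by
  have hY : (Xᶜ).card = m := by rw [card_compl, hX, Fintype.card_fin]; omega
  set S := (univ : Finset (Fin n)).powersetCard 2 \ (Xᶜ).powersetCard 2 with hS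
  have hsub : (Xᶜ).powersetCard 2 ⊆ univ.powersetCard 2 := powersetCard_mono (subset_univ _)
  have hcard : S.card = s.choose 2 + m * s := by
    rw [hS, card_sdiff_of_subset hsub, card_powersetCard, card_powersetCard, hY, card_univ,
      Fintype.card_fin, hm, add_choose_two_eq, Nat.add_sub_cancel_left]
  have hsum : (∑ p ∈ S, (w p : ℝ)) ≤ edgeSum n w X + m * q - m * edgeSum n w X := by
    have h1 := edgeSum_union_le w X (q := q)
      (fun v hv => hF _ (by rw [card_insert_of_notMem hv, hX])) Xᶜ disjoint_compl_right
    rw [union_compl, hY] at h1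
    have h2 : ∑ p ∈ S, w p + edgeSum n w Xᶜ = edgeSum n w univ := sum_sdiff hsub
    have h3 : ∑ p ∈ S, w p + m * edgeSum n w X ≤ edgeSum n w X + m * q := by linarith
    have h4 := (Nat.cast_le (α := ℝ)).2 h3
    push_cast at h4
    linarith
  have hprod : ((∏ p ∈ S, w p : ℕ) : ℝ) * edgeProd n w Xᶜ = edgeProd n w univ := by
    exact_mod_cast prod_sdiff (f := w) hsub
  rw [← hprod, mul_comm]
  push_cast
  refine mul_le_mul_of_nonneg_left ?_ (by positivity)
  refine (prod_le_pow_mul_exp S w hb).trans ?_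
  rw [hcard]
  push_cast
  gcongr

lemma decayRate_mul_add_le {r d a s m L : ℕ} (hda : d < a)
    (ha : d + 2 * (d + 1) ^ 2 * s ≤ a)
    (hm : 4 * (d + 1) * s ^ 2 + 2 * ((r - 1) * (d + 1) + 1) * (s + 1) ≤ m)
    (hL : (d + 1) * s + 1 ≤ ((r - 1) * (d + 1) + 1) * (L + 1)) :
    decayRate r d a * (s.choose 2 + m * s : ℕ) + (1 - m * (L + 1) + s) / (a + 1) ≤ 0 := by
  have hQ : s.choose 2 + m * s ≤ s * s + m * s := by
    have := Nat.choose_le_pow s 2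
    nlinarith
  have hs : s ≤ s * s := Nat.le_mul_self s
  obtain ⟨t, rfl⟩ : ∃ t, a = d + t := ⟨a - d, by omega⟩
  have ht : 0 < t := by omega
  unfold decayRate
  generalize s.choose 2 + m * s = Q at hQ ⊢
  have hN : 0 < (r - 1) * (d + 1) + 1 := by omega
  have hN_cast : ((r - 1 : ℕ) : ℝ) * (d + 1) + 1 = (((r - 1) * (d + 1) + 1 : ℕ) : ℝ) := by
    push_cast; ring
  rw [hN_cast]
  generalize (r - 1) * (d + 1) + 1 = N at hL hN hm ⊢
  have hcast' : ((d : ℝ) + 1) = ((d + 1 : ℕ) : ℝ) := by push_cast; ring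
  have hda' : ((d + t : ℕ) : ℝ) + 1 = t + (d + 1 : ℕ) := by push_cast; ring
  have hda'' : ((d + t : ℕ) : ℝ) - d = t := by push_cast; ring
  rw [hda', hda'', hcast']
  have ha' : 2 * (d + 1) ^ 2 * s ≤ t := by omega
  have hD : 1 ≤ d + 1 := by omega
  generalize d + 1 = D at hD hm hL ha' ⊢
  have key : D * Q * (t + D) + N * t * (1 + s) ≤ N * t * (m * (L + 1)) := by
    have h1 : D * Q * (t + D) ≤ D * (s * s + m * s) * (t + D) := by gcongr
    have h2 : t * m * (D * s + 1) ≤ t * m * (N * (L + 1)) := by gcongr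
    have h3 : (2 * D ^ 2 * s) * (s + m) ≤ t * (s + m) := by gcongr
    have h4 : t * (4 * D * s ^ 2 + 2 * N * (s + 1)) ≤ t * m := by gcongr
    have h5 : t * s ≤ t * (D * (s * s)) := by
      gcongr
      nlinarith
    nlinarith
  have key' := (Nat.cast_le (α := ℝ)).2 key
  push_cast at key'
  have ht' : (0 : ℝ) < t := by exact_mod_cast ht
  have hN' : (0 : ℝ) < N := by exact_mod_cast hN
  have hD' : (0 : ℝ) < D := by exact_mod_cast hD
  have : (D : ℝ) / (N * t) * Q + (1 - m * (L + 1) + s) / (t + D) =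
      (D * Q * (t + D) + N * t * (1 + s) - N * t * (m * (L + 1))) / (N * t * (t + D)) := by
    field_simp
    ring
  rw [this]
  exact div_nonpos_of_nonpos_of_nonneg (by linarith) (by positivity)

lemma decayRate_le {r d a : ℕ} (hda : 2 * d + 1 ≤ a) :
    decayRate r d a ≤ 2 * (d + 1) / (a + 1) := by
  have h : (2 * d + 1 : ℝ) ≤ a := by exact_mod_cast hda
  have hd : (0 : ℝ) ≤ d := Nat.cast_nonneg d
  have hN : (1 : ℝ) ≤ (r - 1 : ℕ) * (d + 1) + 1 := by
    have : (0 : ℝ) ≤ (r - 1 : ℕ) * (d + 1) := by positivity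
    linarith
  unfold decayRate
  rw [div_le_div_iff₀ (mul_pos (by linarith) (by linarith)) (by linarith)]
  have : (a + 1 : ℝ) ≤ 2 * (((r - 1 : ℕ) * (d + 1) + 1) * (a - d)) := by nlinarith
  nlinarith

open Real in
lemma IsF.edgeProd_le_PiT_mul_exp {r d s a n : ℕ} {w : Finset (Fin n) → ℕ} (hr : 2 ≤ r)
    (hs : 1 ≤ s) (hda : 2 * d + 1 ≤ a) (hn : s + 1 ≤ n)
    (hF : IsF n (s + 1) (SigmaT r d a (s + 1)) w) :
    (edgeProd n w univ : ℝ) ≤ PiT r d a n * exp (2 * (d + 1) * n ^ 2 / (a + 1)) := by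
  have hsum : edgeSum n w univ ≤ (a + 1) * n.choose 2 :=
    IsF.edgeSum_le (m := s + 1) (by omega) (fun X hX => (hF X hX).trans (SigmaT_le hr d a _)) n hn
      univ (by simp)
  have hb : (0 : ℝ) < a + 1 := by positivity
  have h1 := prod_le_pow_mul_exp ((univ : Finset (Fin n)).powersetCard 2) w hb
  have h2 : (∑ p ∈ (univ : Finset (Fin n)).powersetCard 2, (w p : ℝ)) ≤
      (a + 1) * n.choose 2 := by exact_mod_cast hsum
  rw [card_powersetCard, card_univ, Fintype.card_fin] at h1
  have h3 : (edgeProd n w univ : ℝ) ≤ (a + 1 : ℝ) ^ n.choose 2 := by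
    unfold edgeProd
    push_cast
    refine h1.trans (mul_le_of_le_one_right (by positivity) (exp_le_one_iff.2 ?_))
    rw [sub_nonpos, div_le_iff₀ hb]
    linarith
  have h4 := pow_mul_exp_le_PiT hr (show d < a by omega) n
  rw [exp_neg, ← div_eq_mul_inv, div_le_iff₀ (exp_pos _)] at h4
  refine h3.trans (h4.trans ?_)
  gcongr
  have h5 : (n.choose 2 : ℝ) ≤ n ^ 2 := by exact_mod_cast Nat.choose_le_pow n 2
  calc decayRate r d a * n.choose 2 ≤ 2 * (d + 1) / (a + 1) * n ^ 2 := by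
        gcongr
        exact decayRate_le hda
    _ = _ := by ring

open Real in
/-- If an `s`-set is too dense, deleting it yields a denser multigraph relative to `PiT`. -/
lemma edgeProd_le_of_dense_subset_of_le {r d s a m n : ℕ} {w : Finset (Fin n) → ℕ} (hr : 2 ≤ r)
    (hda : d < a) (ha : d + 2 * (d + 1) ^ 2 * s ≤ a) (hm1 : 1 ≤ m)
    (hm : 4 * (d + 1) * s ^ 2 + 2 * ((r - 1) * (d + 1) + 1) * (s + 1) ≤ m) (hn : n = m + s)
    (hF : IsF n (s + 1) (SigmaT r d a (s + 1)) w) {X : Finset (Fin n)} (hX : X.card = s)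
    (hXe : SigmaT r d a s < edgeSum n w X) {c : ℝ}
    (hc : (edgeProd n w Xᶜ : ℝ) ≤ PiT r d a m * exp (c / (a + 1))) :
    (edgeProd n w univ : ℝ) ≤ PiT r d a n * exp ((c - s) / (a + 1)) := by
  subst hn
  obtain ⟨L, hL, hNL⟩ := exists_SigmaT_succ_add_le hr d a s hda
  have hb : (0 : ℝ) < a + 1 := by positivity
  have h1 := edgeProd_le_of_dense_subset hb hF hX rfl
  have h2 := PiT_mul_le_PiT_add hr hda m s
  have h3 := decayRate_mul_add_le hda ha hm hNL
  have hSig := (Nat.cast_le (α := ℝ)).2 (SigmaT_le hr d a s)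
  have hXe' : (SigmaT r d a s : ℝ) + 1 ≤ edgeSum (m + s) w X := by exact_mod_cast hXe
  have hL' := (Nat.cast_le (α := ℝ)).2 hL
  push_cast at hSig hL'
  have hm1' : (1 : ℝ) ≤ m := by exact_mod_cast hm1
  set Q := s.choose 2 + m * s with hQ
  have hexp : ((edgeSum (m + s) w X : ℝ) + m * (SigmaT r d a (s + 1) : ℕ) -
      m * edgeSum (m + s) w X) / (a + 1) - (Q : ℝ) ≤ (1 - m * (L + 1)) / (a + 1) := by
    rw [sub_le_iff_le_add, div_add' _ _ _ hb.ne']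
    gcongr
    rw [hQ]
    push_cast
    have h5 := mul_le_mul_of_nonneg_left hL' (zero_le_one.trans hm1')
    have h6 := mul_le_mul_of_nonneg_left hXe' (sub_nonneg.2 hm1')
    linarith
  rw [exp_neg, ← div_eq_mul_inv, ← mul_div_assoc, div_le_iff₀ (exp_pos _)] at h2
  calc (edgeProd (m + s) w univ : ℝ) ≤ _ := h1
    _ ≤ (PiT r d a m * exp (c / (a + 1))) * ((a + 1) ^ Q * exp ((1 - m * (L + 1)) / (a + 1))) := by
        gcongr
    _ = (PiT r d a m * (a + 1) ^ Q) * exp (c / (a + 1) + (1 - m * (L + 1)) / (a + 1)) := by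
        rw [exp_add]; ring
    _ ≤ (PiT r d a (m + s) * exp (decayRate r d a * Q)) *
        exp (c / (a + 1) + (1 - m * (L + 1)) / (a + 1)) := by gcongr
    _ = PiT r d a (m + s) *
        exp (decayRate r d a * Q + (c / (a + 1) + (1 - m * (L + 1)) / (a + 1))) := by
        rw [mul_assoc, ← exp_add]
    _ ≤ _ := by
        gcongr
        have h7 : (c - s) / (a + 1 : ℝ) = c / (a + 1) + (1 - m * (L + 1)) / (a + 1) -
          (1 - m * (L + 1) + s) / (a + 1) := by ring
        rw [h7]
        linarith

lemma IsF.edgeProd_le_PiT {r d a n s q : ℕ} {w : Finset (Fin n) → ℕ} (hr : 2 ≤ r) (hda : d < a)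
    (h : exPi n s q = PiT r d a n) (hF : IsF n s q w) : edgeProd n w univ ≤ PiT r d a n := by
  rw [← h]
  refine le_csSup ?_ ⟨w, hF, rfl⟩
  by_contra hB
  have := PiT_pos hr hda n
  rw [← h, exPi, Nat.sSup_of_not_bddAbove hB] at this
  omega

open Real in
lemma IsF.edgeProd_le_PiT_mul_exp_max {r d s a n₀ : ℕ} (hr : 2 ≤ r) (hs : 1 ≤ s)
    (ha : 2 * d + 1 + 2 * (d + 1) ^ 2 * s ≤ a)
    (hbase : ∀ n, n₀ ≤ n → exPi n s (SigmaT r d a s) = PiT r d a n) {M B : ℕ}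
    (hM : 4 * (d + 1) * s ^ 2 + 2 * ((r - 1) * (d + 1) + 1) * (s + 1) + n₀ + s + 1 ≤ M)
    (hB : 2 * (d + 1) * (M + s) ^ 2 + (M + s) ≤ B) (n : ℕ) (hn : n₀ + s + 1 ≤ n) :
    ∀ w : Finset (Fin n) → ℕ, IsF n (s + 1) (SigmaT r d a (s + 1)) w →
      (edgeProd n w univ : ℝ) ≤ PiT r d a n * exp (max 0 ((B : ℝ) - n) / (a + 1)) := by
  induction n using Nat.strong_induction_on with
  | _ n ih =>
  intro w hF
  have hb : (0 : ℝ) < a + 1 := by positivity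
  by_cases hnM : n < M + s
  · refine (hF.edgeProd_le_PiT_mul_exp hr hs (by omega) (by omega)).trans ?_
    gcongr
    refine le_trans ?_ (le_max_right _ _)
    have h1 : 2 * (d + 1) * n ^ 2 + n ≤ B := le_trans (by gcongr) hB
    have h2 := (Nat.cast_le (α := ℝ)).2 h1
    push_cast at h2
    linarith
  by_cases hFs : IsF n s (SigmaT r d a s) w
  · refine le_trans ?_ (le_mul_of_one_le_right (by positivity) (one_le_exp (by positivity)))
    exact_mod_cast hFs.edgeProd_le_PiT hr (by omega) (hbase n (by omega))
  · unfold IsF at hFs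
    push Not at hFs
    obtain ⟨X, hX, hXe⟩ := hFs
    obtain ⟨m, rfl⟩ : ∃ m, n = m + s := ⟨n - s, by omega⟩
    obtain ⟨e, he⟩ := exists_map_univ_eq (X := Xᶜ) (m := m)
      (by rw [card_compl, hX, Fintype.card_fin]; omega)
    have h1 := ih m (by omega) (by omega) _ (hF.comap e)
    rw [edgeProd_map, he] at h1
    refine (edgeProd_le_of_dense_subset_of_le hr (by omega) (by omega) (by omega) (by omega) rfl
      hF hX hXe h1).trans ?_
    gcongr
    push_cast
    rw [sub_le_iff_le_add]
    refine max_le (by positivity) ?_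
    have := le_max_right (0 : ℝ) (B - (m + s))
    linarith

/-- Step-up theorem: if the case `(s, Σ_{r,d}(a,s))` of the Mubayi–Terry problem is
solved for all large `a` and `n`, then so is the case `(s+1, Σ_{r,d}(a,s+1))`. -/
theorem step_up (r d s : ℕ) (hr : 2 ≤ r) (hs : (r - 1) * (d + 1) + 2 ≤ s)
    (a₀ n₀ : ℕ)
    (hbase : ∀ a : ℕ, a₀ ≤ a → d < a → ∀ n : ℕ, n₀ ≤ n →
      exPi n s (SigmaT r d a s) = PiT r d a n) :
    ∃ a₁ : ℕ, a₀ ≤ a₁ ∧ ∃ n₁ : ℕ, n₀ ≤ n₁ ∧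
      ∀ a : ℕ, a₁ ≤ a → ∀ n : ℕ, n₁ ≤ n →
        exPi n (s + 1) (SigmaT r d a (s + 1)) = PiT r d a n := by
  have hs1 : 1 ≤ s := by omega
  set M := 4 * (d + 1) * s ^ 2 + 2 * ((r - 1) * (d + 1) + 1) * (s + 1) + n₀ + s + 1 with hM
  set B := 2 * (d + 1) * (M + s) ^ 2 + (M + s) with hB
  refine ⟨a₀ + (2 * d + 1 + 2 * (d + 1) ^ 2 * s), by omega, B, by omega, fun a ha n hn => ?_⟩
  have hub : ∀ w : Finset (Fin n) → ℕ, IsF n (s + 1) (SigmaT r d a (s + 1)) w →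
      edgeProd n w univ ≤ PiT r d a n := by
    intro w hF
    have h := IsF.edgeProd_le_PiT_mul_exp_max hr hs1 (by omega)
      (hbase a (by omega) (by omega)) hM.ge hB.ge n (by omega) w hF
    have hBn : (B : ℝ) - n ≤ 0 := sub_nonpos.2 (by exact_mod_cast hn)
    rw [max_eq_left hBn, zero_div, Real.exp_zero, mul_one] at h
    exact_mod_cast h
  obtain ⟨w, hT, hw⟩ := exists_edgeProd_eq_PiT hr d a n
  refine le_antisymm (csSup_le ⟨_, w, hT.isF, rfl⟩ ?_) ?_
  · rintro _ ⟨v, hv, rfl⟩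
    exact hub v hv
  · rw [hw]
    refine le_csSup ⟨PiT r d a n, ?_⟩ ⟨w, hT.isF, rfl⟩
    rintro _ ⟨v, hv, rfl⟩
    exact hub v hv
end

section
/- Sparse case at small excess: let s ≥ 2 be an integer and let q be an integer with C(s,2) < q < C(s,2) + ⌊s/2⌋. Then for every integer n ≥ s, ex_Π(n, s, q) = 2^{q − C(s,2)}. Moreover, for every integer n ≥ s, ex_Π(n, s, C(s,2)) = 1, and ex_Π(n, s, q) = 0 whenever 0 ≤ q < C(s,2). -/
open Finset

/-- If `m ≤ ∑ f` over `S`, then at most `m` elements of `S` already carry a sum of at least `m`. -/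
theorem Finset.exists_subset_card_le_le_sum {ι : Type*} [DecidableEq ι] (f : ι → ℕ)
    (S : Finset ι) (m : ℕ) (h : m ≤ ∑ i ∈ S, f i) :
    ∃ T ⊆ S, T.card ≤ m ∧ m ≤ ∑ i ∈ T, f i := by
  induction S using Finset.induction_on generalizing m with
  | empty => exact ⟨∅, subset_rfl, by simp, h⟩
  | insert a S ha ih =>
    rw [sum_insert ha] at h
    by_cases hz : f a = 0 ∨ m = 0
    · obtain ⟨T, hT, hc, hs⟩ := ih m (by omega)
      exact ⟨T, hT.trans (subset_insert a S), hc, hs⟩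
    · obtain ⟨T, hT, hc, hs⟩ := ih (m - f a) (by omega)
      refine ⟨insert a T, insert_subset_insert a hT, ?_, ?_⟩
      · rw [card_insert_of_notMem fun h' => ha (hT h')]; omega
      · rw [sum_insert fun h' => ha (hT h')]; omega

/-- The edge sum of a multigraph without zero multiplicities, split into the complete graph and
the excess. -/
theorem edgeSum_eq_choose_add {n : ℕ} {w : Finset (Fin n) → ℕ} {X : Finset (Fin n)}
    (hw : ∀ p ∈ X.powersetCard 2, 1 ≤ w p) :
    edgeSum n w X = X.card.choose 2 + ∑ p ∈ X.powersetCard 2, (w p - 1) := by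
  rw [← card_powersetCard, card_eq_sum_ones, ← sum_add_distrib]
  exact sum_congr rfl fun p hp => by have := hw p hp; omega

theorem one_le_of_edgeProd_univ_ne_zero {n : ℕ} {w : Finset (Fin n) → ℕ}
    (hP : edgeProd n w univ ≠ 0) (X : Finset (Fin n)) :
    ∀ p ∈ X.powersetCard 2, 1 ≤ w p := fun p hp =>
  Nat.one_le_iff_ne_zero.2
    (prod_ne_zero_iff.1 hP p (powersetCard_mono (subset_univ X) hp))

/-- The total excess of a nowhere-zero `(n,s,C(s,2)+t)`-graph with `t < ⌊s/2⌋` is at most `t`. -/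
theorem excess_le {n s t : ℕ} (ht : t < s / 2) (hn : s ≤ n) {w : Finset (Fin n) → ℕ}
    (hw : IsF n s (s.choose 2 + t) w) (hP : edgeProd n w univ ≠ 0) :
    ∑ p ∈ (univ : Finset (Fin n)).powersetCard 2, (w p - 1) ≤ t := by
  by_contra! hlt
  obtain ⟨T, hT, hc, hs⟩ := Finset.exists_subset_card_le_le_sum _ _ (t + 1) hlt
  have hU : (T.biUnion id).card ≤ s :=
    (card_biUnion_le_card_mul T id 2 fun p hp => (mem_powersetCard.1 (hT hp)).2.le).trans
      (by omega)
  obtain ⟨X, hX, hXs⟩ := exists_superset_card_eq hU (by simpa using hn)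
  have hTX : T ⊆ X.powersetCard 2 := fun p hp =>
    mem_powersetCard.2
      ⟨(subset_biUnion_of_mem id hp).trans hX, (mem_powersetCard.1 (hT hp)).2⟩
  have h1 := hw X hXs
  rw [edgeSum_eq_choose_add (one_le_of_edgeProd_univ_ne_zero hP X), hXs] at h1
  have h2 := sum_le_sum_of_subset (f := fun p => w p - 1) hTX
  omega

theorem edgeProd_le_two_pow {n s t : ℕ} (ht : t < s / 2) (hn : s ≤ n)
    {w : Finset (Fin n) → ℕ} (hw : IsF n s (s.choose 2 + t) w) :
    edgeProd n w univ ≤ 2 ^ t := by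
  by_cases hP : edgeProd n w univ = 0
  · simp [hP]
  calc edgeProd n w univ
      ≤ ∏ p ∈ (univ : Finset (Fin n)).powersetCard 2, 2 ^ (w p - 1) :=
        prod_le_prod' fun p _ => by
          have := Nat.lt_two_pow_self (n := w p - 1)
          omega
    _ = 2 ^ ∑ p ∈ (univ : Finset (Fin n)).powersetCard 2, (w p - 1) :=
        prod_pow_eq_pow_sum _ _ _
    _ ≤ 2 ^ t := Nat.pow_le_pow_right two_pos (excess_le ht hn hw hP)

/-- Doubling `t` edges of the complete graph gives an `(n,s,C(s,2)+t)`-graph. -/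
theorem exists_isF_edgeProd_eq_two_pow {n t : ℕ} (s : ℕ) (ht : t ≤ n.choose 2) :
    ∃ w : Finset (Fin n) → ℕ, IsF n s (s.choose 2 + t) w ∧ 2 ^ t = edgeProd n w univ := by
  obtain ⟨T, hT, hc⟩ := exists_subset_card_eq
    (s := (univ : Finset (Fin n)).powersetCard 2) (n := t) (by simpa using ht)
  refine ⟨fun p => if p ∈ T then 2 else 1, fun X hX => ?_, ?_⟩
  · rw [edgeSum_eq_choose_add fun p _ => by split_ifs <;> omega, hX, ← hc]
    refine Nat.add_le_add_left ?_ _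
    calc ∑ p ∈ X.powersetCard 2, ((if p ∈ T then 2 else 1) - 1)
        = ∑ p ∈ X.powersetCard 2, if p ∈ T then 1 else 0 :=
          sum_congr rfl fun p _ => by split_ifs <;> rfl
      _ = ((X.powersetCard 2).filter (· ∈ T)).card := (card_filter _ _).symm
      _ ≤ T.card := card_le_card fun p hp => (mem_filter.1 hp).2
  · rw [edgeProd, prod_ite, prod_const, prod_const_one, mul_one, filter_mem_eq_inter,
      inter_eq_right.2 hT, hc]

theorem exPi_choose_add {n s t : ℕ} (ht : t < s / 2) (hn : s ≤ n) :
    exPi n s (s.choose 2 + t) = 2 ^ t := by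
  have hs : t ≤ n.choose 2 := by
    refine le_trans ?_ (Nat.choose_le_choose 2 hn)
    rw [Nat.choose_two_right]
    exact ht.le.trans (Nat.div_le_div_right (Nat.le_mul_of_pos_right s (by omega)))
  refine IsGreatest.csSup_eq ⟨exists_isF_edgeProd_eq_two_pow s hs, ?_⟩
  rintro _ ⟨w, hw, rfl⟩
  exact edgeProd_le_two_pow ht hn hw

theorem edgeProd_eq_zero_of_lt_choose {n s q : ℕ} (hn : s ≤ n) (hq : q < s.choose 2)
    {w : Finset (Fin n) → ℕ} (hw : IsF n s q w) : edgeProd n w univ = 0 := by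
  by_contra hP
  obtain ⟨X, -, hX⟩ := exists_subset_card_eq
    (s := (univ : Finset (Fin n))) (n := s) (by simpa using hn)
  have h := hw X hX
  rw [edgeSum_eq_choose_add (one_le_of_edgeProd_univ_ne_zero hP X), hX] at h
  omega

theorem exPi_eq_zero_of_lt_choose {n s q : ℕ} (hn : s ≤ n) (hq : q < s.choose 2) :
    exPi n s q = 0 := by
  refine Nat.le_zero.1 (csSup_le' ?_)
  rintro _ ⟨w, hw, rfl⟩
  exact (edgeProd_eq_zero_of_lt_choose hn hq hw).le

/-- Sparse case at small excess: for `s ≥ 2`: if `C(s,2) < q < C(s,2) + ⌊s/2⌋` then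
`ex_Π(n,s,q) = 2^{q - C(s,2)}` for all `n ≥ s`; moreover `ex_Π(n,s,C(s,2)) = 1` and
`ex_Π(n,s,q) = 0` whenever `q < C(s,2)`, for all `n ≥ s`. -/
theorem sparse_small_excess (s : ℕ) (hs : 2 ≤ s) :
    (∀ q : ℕ, Nat.choose s 2 < q → q < Nat.choose s 2 + s / 2 →
      ∀ n : ℕ, s ≤ n → exPi n s q = 2 ^ (q - Nat.choose s 2)) ∧
    (∀ n : ℕ, s ≤ n → exPi n s (Nat.choose s 2) = 1) ∧
    (∀ q n : ℕ, s ≤ n → q < Nat.choose s 2 → exPi n s q = 0) := by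
  refine ⟨fun q hq hq' n hn => ?_, fun n hn => ?_,
    fun q n hn hq => exPi_eq_zero_of_lt_choose hn hq⟩
  · obtain ⟨t, rfl⟩ := Nat.exists_eq_add_of_lt hq
    rw [add_assoc, Nat.add_sub_cancel_left]
    exact exPi_choose_add (by omega) hn
  · exact exPi_choose_add (t := 0) (by omega) hn
end
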